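/- arXiv:math/0601225 — 2 statements merged into one kernel-verified Lean document; each statement's English description precedes it below -/
import Mathlib

section
/- Let X_7 be the blow-up of the complex projective plane at 7 distinct points x_1, …, x_7 in general position, and let x be a point of X_7 in general position. Then there exists an irreducible and reduced member D_x of the linear system |−2K_{X_7}| with mult_x D_x = 3. Equivalently, there exists an irreducible and reduced plane curve of degree 6 with multiplicity exactly 3 at μ_7(x) and multiplicity exactly 2 at each of the points x_1, …, x_7. -/
open MvPolynomial

noncomputable section

/-- The complex projective plane `ℙ²`, as the projectivization of `ℂ³`. -/
abbrev P2 : Type := Projectivization ℂ (Fin 3 → ℂ)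

/-- The iterated partial derivative `∂₀^(k 0) ∂₁^(k 1) ∂₂^(k 2) F` of a polynomial in three
variables. -/
def iterDeriv (k : Fin 3 → ℕ) (F : MvPolynomial (Fin 3) ℂ) : MvPolynomial (Fin 3) ℂ :=
  (fun G => pderiv (0 : Fin 3) G)^[k 0] <|
    (fun G => pderiv (1 : Fin 3) G)^[k 1] <|
      (fun G => pderiv (2 : Fin 3) G)^[k 2] F

/-- `F` vanishes to order at least `m` at the vector `v` : all partial derivatives of total
order `< m` vanish at `v`.  (For `F` homogeneous this is invariant under scaling of `v`, and
for `v ≠ 0` it is the multiplicity condition at the corresponding projective point.) -/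
def HasMultGE (F : MvPolynomial (Fin 3) ℂ) (v : Fin 3 → ℂ) (m : ℕ) : Prop :=
  ∀ k : Fin 3 → ℕ, k 0 + k 1 + k 2 < m → eval v (iterDeriv k F) = 0

/-- `F` vanishes to order at least `m` at the projective point `p`. -/
def pHasMultGE (F : MvPolynomial (Fin 3) ℂ) (p : P2) (m : ℕ) : Prop :=
  HasMultGE F p.rep m

/-- The multiplicity of the plane curve `{F = 0}` at the projective point `p`
(the largest `m` such that all partials of order `< m` vanish at `p`). -/
def pMult (F : MvPolynomial (Fin 3) ℂ) (p : P2) : ℕ :=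
  sSup {m : ℕ | pHasMultGE F p m}

/-- The plane curve `{F = 0}` passes through the projective point `p`. -/
def pVanish (F : MvPolynomial (Fin 3) ℂ) (p : P2) : Prop :=
  eval p.rep F = 0

/-- The plane curve `{F = 0}` is smooth (every point of it is a nonsingular point). -/
def SmoothPlaneCurve (F : MvPolynomial (Fin 3) ℂ) : Prop :=
  ∀ p : P2, pVanish F p → ∃ i : Fin 3, eval p.rep (pderiv i F) ≠ 0

/-- `p` is a singular point of the plane curve `{F = 0}`. -/
def SingularAt (F : MvPolynomial (Fin 3) ℂ) (p : P2) : Prop :=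
  pVanish F p ∧ ∀ i : Fin 3, eval p.rep (pderiv i F) = 0

/-- A tuple of points of `ℙ²` is in general position if the points are pairwise distinct,
no `3` of them lie on a line, no `6` of them lie on a conic, and no `8` of them lie on a
cubic which is singular at one of them. -/
def GenPos {n : ℕ} (p : Fin n → P2) : Prop :=
  Function.Injective p ∧
  (∀ f : Fin 3 ↪ Fin n, ¬ ∃ L : MvPolynomial (Fin 3) ℂ,
      L ≠ 0 ∧ L.IsHomogeneous 1 ∧ ∀ k, pVanish L (p (f k))) ∧
  (∀ f : Fin 6 ↪ Fin n, ¬ ∃ Q : MvPolynomial (Fin 3) ℂ,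
      Q ≠ 0 ∧ Q.IsHomogeneous 2 ∧ ∀ k, pVanish Q (p (f k))) ∧
  (∀ f : Fin 8 ↪ Fin n, ¬ ∃ F : MvPolynomial (Fin 3) ℂ,
      F ≠ 0 ∧ F.IsHomogeneous 3 ∧ (∀ k, pVanish F (p (f k))) ∧ ∃ k, pHasMultGE F (p (f k)) 2)

/-- The irreducible plane curve `{F = 0}` is rational: it admits a nonconstant parametrization
by `ℙ¹`, given by a triple of homogeneous polynomials of the same degree in two variables. -/
def RatPlaneCurve (F : MvPolynomial (Fin 3) ℂ) : Prop :=
  ∃ (φ : Fin 3 → MvPolynomial (Fin 2) ℂ) (e : ℕ),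
    (∀ j, (φ j).IsHomogeneous e) ∧
    (∃ s t : Fin 2 → ℂ, ∀ c : ℂ,
      (fun j => eval s (φ j)) ≠ c • fun j => eval t (φ j)) ∧
    aeval φ F = 0

/-- Data of the blow-up `X` of `ℙ²` at the `r` distinct points `pts`, together with its theory
of (irreducible, reduced) curves:  `mem x C` says that `x` lies on the curve `C`, `mult x C`
is the multiplicity of `C` at `x`, the class of a curve `C` in `Pic X = ℤH ⊕ ⨁ᵢ ℤEᵢ` is
`degH C · H - ∑ i, multE C i · Eᵢ`, `interK C` is the intersection number `(-K_X)·C`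
(so `interK C = 3 degH C - ∑ i multE C i`), `rational C` (resp. `nodal C`) says that `C` is a
rational (resp. nodal) curve, and `Eexc i` is the exceptional curve over `pts i`.
Away from the blown-up points, the blow-up map `μ` is a bijection, and the non-exceptional
curves are exactly the strict transforms of the irreducible plane curves, with the
corresponding classes and multiplicities. -/
structure BlowupP2 (r : ℕ) (pts : Fin r → P2) where
  X : Type
  μ : X → P2
  μ_surj : Function.Surjective μ
  μ_unique : ∀ q : P2, q ∉ Set.range pts → ∃! x : X, μ x = q
  Curve : Type
  mem : X → Curve → Prop
  mult : X → Curve → ℕ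
  mult_pos_iff : ∀ (x : X) (C : Curve), 0 < mult x C ↔ mem x C
  degH : Curve → ℕ
  multE : Curve → Fin r → ℤ
  interK : Curve → ℤ
  interK_eq : ∀ C : Curve, interK C = 3 * (degH C : ℤ) - ∑ i, multE C i
  rational : Curve → Prop
  nodal : Curve → Prop
  nodal_mult : ∀ C : Curve, nodal C → ∀ x : X, mult x C ≤ 2
  Eexc : Fin r → Curve
  mem_exc : ∀ (i : Fin r) (x : X), mem x (Eexc i) ↔ μ x = pts i
  exc_degH : ∀ i, degH (Eexc i) = 0
  exc_multE_self : ∀ i, multE (Eexc i) i = -1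
  exc_multE_ne : ∀ i j, i ≠ j → multE (Eexc i) j = 0
  exc_rational : ∀ i, rational (Eexc i)
  strict_exists : ∀ (d : ℕ) (F : MvPolynomial (Fin 3) ℂ),
    F.IsHomogeneous d → Irreducible F →
    ∃ C : Curve, degH C = d ∧ (∀ i, multE C i = (pMult F (pts i) : ℤ)) ∧
      (∀ x : X, μ x ∉ Set.range pts →
        ((mem x C ↔ pVanish F (μ x)) ∧ mult x C = pMult F (μ x))) ∧
      (rational C ↔ RatPlaneCurve F)
  curve_cases : ∀ C : Curve, (∃ i, C = Eexc i) ∨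
    ∃ (d : ℕ) (F : MvPolynomial (Fin 3) ℂ),
      F.IsHomogeneous d ∧ Irreducible F ∧
      degH C = d ∧ (∀ i, multE C i = (pMult F (pts i) : ℤ)) ∧
      (∀ x : X, μ x ∉ Set.range pts →
        ((mem x C ↔ pVanish F (μ x)) ∧ mult x C = pMult F (μ x))) ∧
      (rational C ↔ RatPlaneCurve F)

namespace BlowupP2

variable {r : ℕ} {pts : Fin r → P2}

/-- The Seshadri constant of the anticanonical divisor `-K_X` at a point `x` of the blow-up:
the infimum over all irreducible curves `C` through `x` of `((-K_X)·C) / mult_x C`. -/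
def seshadri (B : BlowupP2 r pts) (x : B.X) : ℝ :=
  sInf {t : ℝ | ∃ C : B.Curve, B.mem x C ∧ t = (B.interK C : ℝ) / (B.mult x C : ℝ)}

/-- A point `x` of the blow-up of `ℙ²` at `pts` is in general position if its image `μ x` is
distinct from the blown-up points and the points `pts` together with `μ x` are in general
position. -/
def genPosPt (B : BlowupP2 r pts) (x : B.X) : Prop :=
  B.μ x ∉ Set.range pts ∧ GenPos (Fin.snoc pts (B.μ x))

end BlowupP2

/-- The zero locus in `(ℙ²)^r` of a polynomial in the coordinates of the `r` points. -/
def projZeroSet {r : ℕ} (f : MvPolynomial (Fin r × Fin 3) ℂ) : Set (Fin r → P2) :=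
  {p | eval (fun q => (p q.1).rep q.2) f = 0}

/-- The vanishing of `f` at a tuple of nonzero vectors only depends on the corresponding tuple
of projective points (so that `projZeroSet f` is a well-defined closed subvariety of
`(ℙ²)^r`). -/
def GoodFamilyPoly (r : ℕ) (f : MvPolynomial (Fin r × Fin 3) ℂ) : Prop :=
  ∀ v w : Fin r → Fin 3 → ℂ,
    (∀ i, ∃ c : ℂ, c ≠ 0 ∧ w i = c • v i) →
    (eval (fun q => v q.1 q.2) f = 0 → eval (fun q => w q.1 q.2) f = 0)

/-- `P` holds for every tuple of `r` points of `ℙ²` in very general position: there is a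
countable family of proper closed hypersurfaces of `(ℙ²)^r` such that `P p` holds for every
tuple `p` avoiding all of them. -/
def VeryGeneralHolds (r : ℕ) (P : (Fin r → P2) → Prop) : Prop :=
  ∃ bad : ℕ → MvPolynomial (Fin r × Fin 3) ℂ,
    (∀ n, GoodFamilyPoly r (bad n)) ∧
    (∀ n, projZeroSet (bad n) ≠ Set.univ) ∧
    ∀ p : Fin r → P2, (∀ n, p ∉ projZeroSet (bad n)) → P p

/-! ### Multiplicities via translation and orders of power series -/

abbrev Poly3 : Type := MvPolynomial (Fin 3) ℂ

/-- Translation by `v`. -/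
def trl (v : Fin 3 → ℂ) : Poly3 →ₐ[ℂ] Poly3 := aeval (fun i => X i + C (v i))

/-- The ideal of the vector `v`. -/
def vI (v : Fin 3 → ℂ) : Ideal Poly3 := RingHom.ker (eval v)

/-- order of vanishing. -/
def vord (v : Fin 3 → ℂ) (F : Poly3) : ℕ∞ := ((trl v F : Poly3) : MvPowerSeries (Fin 3) ℂ).order

lemma trl_X (v : Fin 3 → ℂ) (i : Fin 3) : trl v (X i) = X i + C (v i) := by simp [trl]

lemma trl_neg_trl (v : Fin 3 → ℂ) (F : Poly3) : trl (-v) (trl v F) = F := by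
  have : (trl (-v)).comp (trl v) = AlgHom.id ℂ Poly3 := by
    ext i : 1
    simp [trl]
  exact DFunLike.congr_fun this F

lemma trl_ne_zero {v : Fin 3 → ℂ} {F : Poly3} (h : F ≠ 0) : trl v F ≠ 0 := by
  intro h0
  apply h
  rw [← trl_neg_trl v F, h0, map_zero]

lemma eval_trl (v w : Fin 3 → ℂ) (F : Poly3) : eval w (trl v F) = eval (w + v) F := by
  have : (eval w).comp (trl v : Poly3 →+* Poly3) = eval (w + v) := by
    apply MvPolynomial.ringHom_ext <;> intros <;> simp [trl]
  exact DFunLike.congr_fun this F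

lemma constCoeff_trl (v : Fin 3 → ℂ) (F : Poly3) : coeff 0 (trl v F) = eval v F := by
  have := eval_trl v 0 F
  rw [zero_add] at this
  rw [← this, ← constantCoeff_eq, ← eval_zero']
  rfl

lemma le_vord_iff_coeff (v : Fin 3 → ℂ) (F : Poly3) (m : ℕ) :
    (m : ℕ∞) ≤ vord v F ↔ ∀ k : Fin 3 →₀ ℕ, k.degree < m → coeff k (trl v F) = 0 := by
  constructor
  · intro h k hk
    have := MvPowerSeries.coeff_of_lt_order (f := ((trl v F : Poly3) : MvPowerSeries (Fin 3) ℂ))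
      (d := k) (lt_of_lt_of_le (by exact_mod_cast hk) h)
    simpa using this
  · intro h
    apply MvPowerSeries.nat_le_order
    intro d hd
    simpa using h d hd

lemma mem_vI_pow_iff (v : Fin 3 → ℂ) (F : Poly3) (m : ℕ) :
    F ∈ vI v ^ m ↔ (m : ℕ∞) ≤ vord v F := by
  rw [le_vord_iff_coeff, ← mem_pow_idealOfVars_iff']
  constructor
  · intro h
    have h1 : vI v ≤ (idealOfVars (Fin 3) ℂ).comap (trl v) := by
      intro G hG
      rw [Ideal.mem_comap, ← pow_one (idealOfVars (Fin 3) ℂ), mem_pow_idealOfVars_iff']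
      intro x hx
      have : x = 0 := by
        rw [← Finsupp.degree_eq_zero_iff]; omega
      rw [this, constCoeff_trl]
      exact hG
    have := (Ideal.pow_right_mono h1 m).trans (Ideal.le_comap_pow (trl v) m)
    exact this h
  · intro h
    have h1 : (idealOfVars (Fin 3) ℂ) ≤ (vI v).comap (trl (-v)) := by
      rw [Ideal.span_le]
      rintro _ ⟨i, rfl⟩
      simp [trl, vI]
    have := ((Ideal.pow_right_mono h1 m).trans (Ideal.le_comap_pow (trl (-v)) m)) h
    rw [Ideal.mem_comap, trl_neg_trl] at this
    exact this

lemma vord_mul (v : Fin 3 → ℂ) (F G : Poly3) : vord v (F * G) = vord v F + vord v G := by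
  simp [vord, MvPowerSeries.order_mul]

lemma vord_ne_top {v : Fin 3 → ℂ} {F : Poly3} (h : F ≠ 0) : vord v F ≠ ⊤ := by
  intro h0
  rw [vord, MvPowerSeries.order_eq_top_iff] at h0
  exact trl_ne_zero h (MvPolynomial.coe_eq_zero_iff.mp h0)

/-- natural number valued multiplicity. -/
def vm (v : Fin 3 → ℂ) (F : Poly3) : ℕ := (vord v F).toNat

lemma le_vm_iff {v : Fin 3 → ℂ} {F : Poly3} (h : F ≠ 0) (m : ℕ) : m ≤ vm v F ↔ F ∈ vI v ^ m := by
  rw [mem_vI_pow_iff, vm]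
  lift vord v F to ℕ using vord_ne_top h with n
  simp

lemma vm_mul {v : Fin 3 → ℂ} {F G : Poly3} (hF : F ≠ 0) (hG : G ≠ 0) :
    vm v (F * G) = vm v F + vm v G := by
  rw [vm, vm, vm, vord_mul, ENat.toNat_add (vord_ne_top hF) (vord_ne_top hG)]

lemma pderiv_trl (v : Fin 3 → ℂ) (i : Fin 3) (F : Poly3) :
    pderiv i (trl v F) = trl v (pderiv i F) := by
  induction F using MvPolynomial.induction_on with
  | C a => simp [trl]
  | add p q hp hq => simp [hp, hq]
  | mul_X p j hp =>
    simp only [map_mul, pderiv_mul, hp, trl_X, map_add, pderiv_C, add_zero]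
    by_cases hij : j = i
    · subst hij; simp
    · simp [pderiv_X_of_ne hij]

lemma pderiv_iter_trl (v : Fin 3 → ℂ) (i : Fin 3) (n : ℕ) (F : Poly3) :
    (fun G => pderiv i G)^[n] (trl v F) = trl v ((fun G => pderiv i G)^[n] F) := by
  induction n generalizing F with
  | zero => rfl
  | succ n ih => simp only [Function.iterate_succ_apply, pderiv_trl, ih]

lemma iterDeriv_trl (v : Fin 3 → ℂ) (k : Fin 3 → ℕ) (F : Poly3) :
    iterDeriv k (trl v F) = trl v (iterDeriv k F) := by
  simp only [iterDeriv, pderiv_iter_trl]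

lemma coeff_pderiv_iter (i : Fin 3) (n : ℕ) (k : Fin 3 →₀ ℕ) :
    ∃ c : ℂ, c ≠ 0 ∧ ∀ F : Poly3, coeff k ((fun G => pderiv i G)^[n] F) =
      c * coeff (k + Finsupp.single i n) F := by
  induction n with
  | zero => exact ⟨1, one_ne_zero, fun F => by simp⟩
  | succ n ih =>
    obtain ⟨c, hc, h⟩ := ih
    refine ⟨c * ((k + Finsupp.single i n) i + 1 : ℕ), mul_ne_zero hc (Nat.cast_ne_zero.2 (Nat.succ_ne_zero _)), fun F => ?_⟩
    rw [Function.iterate_succ_apply, h, coeff_pderiv, add_assoc, ← Finsupp.single_add]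
    push_cast
    ring

def toF (k : Fin 3 → ℕ) : Fin 3 →₀ ℕ := Finsupp.equivFunOnFinite.symm k

lemma toF_eq (k : Fin 3 → ℕ) : toF k =
    Finsupp.single 0 (k 0) + Finsupp.single 1 (k 1) + Finsupp.single 2 (k 2) := by
  ext i; fin_cases i <;> simp [toF]

lemma toF_degree (k : Fin 3 → ℕ) : (toF k).degree = k 0 + k 1 + k 2 := by
  rw [toF_eq]; simp

lemma coeff_iterDeriv (k : Fin 3 → ℕ) :
    ∃ c : ℂ, c ≠ 0 ∧ ∀ F : Poly3, coeff 0 (iterDeriv k F) = c * coeff (toF k) F := by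
  obtain ⟨c0, h0, e0⟩ := coeff_pderiv_iter 0 (k 0) 0
  obtain ⟨c1, h1, e1⟩ := coeff_pderiv_iter 1 (k 1) (0 + Finsupp.single 0 (k 0))
  obtain ⟨c2, h2, e2⟩ := coeff_pderiv_iter 2 (k 2) (0 + Finsupp.single 0 (k 0) + Finsupp.single 1 (k 1))
  refine ⟨c0 * c1 * c2, by simp [*], fun F => ?_⟩
  rw [iterDeriv, e0, e1, e2, toF_eq, zero_add]
  ring

lemma hasMultGE_iff (F : Poly3) (v : Fin 3 → ℂ) (m : ℕ) : HasMultGE F v m ↔ F ∈ vI v ^ m := by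
  rw [mem_vI_pow_iff, le_vord_iff_coeff]
  have key : ∀ k, eval v (iterDeriv k F) = 0 ↔ coeff (toF k) (trl v F) = 0 := by
    intro k
    obtain ⟨c, hc, h⟩ := coeff_iterDeriv k
    rw [← constCoeff_trl, ← iterDeriv_trl, h]
    simp [hc]
  constructor
  · intro h k hk
    have e : toF k = k := by ext; simp [toF]
    have := (key k).1 (h k (by rwa [← toF_degree, e]))
    rwa [e] at this
  · intro h k hk
    exact (key k).2 (h _ (by rwa [toF_degree]))

lemma pMult_eq {F : Poly3} (hF : F ≠ 0) (p : P2) : pMult F p = vm p.rep F := by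
  have : {m : ℕ | pHasMultGE F p m} = Set.Iic (vm p.rep F) := by
    ext m
    simp only [Set.mem_ofPred_eq, Set.mem_Iic, pHasMultGE, hasMultGE_iff, le_vm_iff hF]
  rw [pMult, this, csSup_Iic]

/-! ### Factors of homogeneous polynomials -/

lemma trl_zero (F : Poly3) : trl 0 F = F := by
  simp [trl]

lemma degree_le_td {F : Poly3} {k : Fin 3 →₀ ℕ} (hk : coeff k F ≠ 0) : k.degree ≤ F.totalDegree :=
  le_totalDegree (mem_support_iff.2 hk)

lemma vm_zero_le_degree {F : Poly3} (hF : F ≠ 0) {k : Fin 3 →₀ ℕ} (hk : coeff k F ≠ 0) :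
    vm 0 F ≤ k.degree := by
  by_contra hlt
  push Not at hlt
  have := (mem_vI_pow_iff 0 F (vm 0 F)).1 ((le_vm_iff hF _).1 le_rfl)
  rw [le_vord_iff_coeff] at this
  have := this k hlt
  rw [trl_zero] at this
  exact hk this

lemma vm_zero_le {F : Poly3} (hF : F ≠ 0) : vm 0 F ≤ F.totalDegree := by
  obtain ⟨k, hk⟩ := MvPolynomial.ne_zero_iff.1 hF
  exact (vm_zero_le_degree hF hk).trans (degree_le_td hk)

lemma homog_of_eq {F : Poly3} (hF : F ≠ 0) (h : vm 0 F = F.totalDegree) :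
    F.IsHomogeneous F.totalDegree := by
  intro k hk
  have e : Finsupp.weight (1 : Fin 3 → ℕ) k = k.degree :=
    (DFunLike.congr_fun Finsupp.degree_eq_weight_one k).symm
  rw [e]
  exact le_antisymm (degree_le_td hk) (h ▸ vm_zero_le_degree hF hk)

lemma vm_zero_homog {F : Poly3} (hF : F ≠ 0) {d : ℕ} (h : F.IsHomogeneous d) : d ≤ vm 0 F := by
  rw [le_vm_iff hF, mem_vI_pow_iff, le_vord_iff_coeff, trl_zero]
  intro k hk
  exact h.coeff_eq_zero hk.ne

lemma homog_factors {F G : Poly3} {d : ℕ} (h : (F * G).IsHomogeneous d) (h0 : F * G ≠ 0) :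
    ∃ a b, a + b = d ∧ F.IsHomogeneous a ∧ G.IsHomogeneous b := by
  have hF : F ≠ 0 := left_ne_zero_of_mul h0
  have hG : G ≠ 0 := right_ne_zero_of_mul h0
  have h1 := vm_zero_homog h0 h
  have h2 := h.totalDegree h0
  rw [vm_mul hF hG] at h1
  rw [totalDegree_mul_of_isDomain hF hG] at h2
  have h3 := vm_zero_le hF
  have h4 := vm_zero_le hG
  exact ⟨_, _, h2, homog_of_eq hF (by omega), homog_of_eq hG (by omega)⟩

lemma homog_aeval_smul {S : Type*} [CommRing S] [Algebra ℂ S] {F : Poly3} {d : ℕ}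
    (h : F.IsHomogeneous d) (c : S) (g : Fin 3 → S) :
    aeval (fun i => c * g i) F = c ^ d * aeval g F := by
  rw [aeval_def, aeval_def, eval₂_eq, eval₂_eq, Finset.mul_sum]
  refine Finset.sum_congr rfl fun k hk => ?_
  have hk' : k.degree = d := by
    by_contra hne
    exact (mem_support_iff.1 hk) (h.coeff_eq_zero hne)
  simp only [mul_pow, Finset.prod_mul_distrib, Finset.prod_pow_eq_pow_sum]
  rw [show ∑ i ∈ k.support, k i = d from hk']
  ring

lemma homog_eval_smul {F : Poly3} {d : ℕ}
    (h : F.IsHomogeneous d) (c : ℂ) (g : Fin 3 → ℂ) :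
    eval (c • g) F = c ^ d * eval g F := by
  have := homog_aeval_smul h c g
  rwa [MvPolynomial.aeval_eq_eval] at this

lemma isUnit_of_homog_zero {F : Poly3} (h0 : F ≠ 0) (h : F.IsHomogeneous 0) : IsUnit F := by
  have := (totalDegree_zero_iff_isHomogeneous _).2 h
  rw [totalDegree_eq_zero_iff_eq_C] at this
  rw [this]
  refine (isUnit_iff_ne_zero.2 ?_).map C
  intro h1
  rw [h1, C_0] at this
  exact h0 this

/-! ### Linear coordinate changes -/

/-- Linear substitution. -/
def lsub (M : Matrix (Fin 3) (Fin 3) ℂ) : Poly3 →ₐ[ℂ] Poly3 :=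
  aeval (fun j => ∑ l, C (M j l) * X l)

lemma eval_lsub (M : Matrix (Fin 3) (Fin 3) ℂ) (v : Fin 3 → ℂ) (F : Poly3) :
    eval v (lsub M F) = eval (M.mulVec v) F := by
  have : (eval v).comp (lsub M : Poly3 →+* Poly3) = eval (M.mulVec v) := by
    apply MvPolynomial.ringHom_ext <;> intros <;> simp [lsub, Matrix.mulVec, dotProduct]
  exact DFunLike.congr_fun this F

lemma lsub_lsub (M N : Matrix (Fin 3) (Fin 3) ℂ) (h : M * N = 1) (F : Poly3) :
    lsub N (lsub M F) = F := by
  apply MvPolynomial.funext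
  intro v
  rw [eval_lsub, eval_lsub, Matrix.mulVec_mulVec, h, Matrix.one_mulVec]

lemma lsub_homog (M : Matrix (Fin 3) (Fin 3) ℂ) {F : Poly3} {d : ℕ} (h : F.IsHomogeneous d) :
    (lsub M F).IsHomogeneous d := by
  have := h.aeval (n := 1) (fun j => ∑ l, C (M j l) * X l) (fun j => by
    apply IsHomogeneous.sum
    intro l _
    exact isHomogeneous_C_mul_X _ _)
  rwa [one_mul] at this

lemma map_vI_pow {S : Type*} [CommRing S] (φ : Poly3 →+* S) (v : Fin 3 → ℂ) (J : Ideal S)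
    (h : ∀ G : Poly3, eval v G = 0 → φ G ∈ J) {F : Poly3} {m : ℕ} (hF : F ∈ vI v ^ m) :
    φ F ∈ J ^ m := by
  have h1 : vI v ≤ J.comap φ := fun G hG => h G hG
  exact ((Ideal.pow_right_mono h1 m).trans (Ideal.le_comap_pow φ m)) hF

lemma lsub_mem (M : Matrix (Fin 3) (Fin 3) ℂ) {v : Fin 3 → ℂ} {F : Poly3} {m : ℕ}
    (hF : F ∈ vI (M.mulVec v) ^ m) : lsub M F ∈ vI v ^ m := by
  refine map_vI_pow (lsub M : Poly3 →+* Poly3) _ _ (fun G hG => ?_) hF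
  show eval v (lsub M G) = 0
  rw [eval_lsub, hG]

lemma smul_mem_vI {F : Poly3} {d : ℕ} (h : F.IsHomogeneous d) {c : ℂ} (hc : c ≠ 0)
    {v : Fin 3 → ℂ} {m : ℕ} (hF : F ∈ vI v ^ m) : F ∈ vI (c • v) ^ m := by
  have h1 : lsub (c⁻¹ • 1) F ∈ vI (c • v) ^ m := by
    apply lsub_mem
    rwa [Matrix.smul_mulVec, Matrix.one_mulVec, smul_smul, inv_mul_cancel₀ hc, one_smul]
  have h2 : lsub (c⁻¹ • 1) F = C ((c⁻¹) ^ d) * F := by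
    apply MvPolynomial.funext
    intro w
    rw [eval_lsub, Matrix.smul_mulVec, Matrix.one_mulVec, homog_eval_smul h]
    simp
  rw [h2] at h1
  have := Ideal.mul_mem_left _ (C (c ^ d)) h1
  rwa [← mul_assoc, ← C_mul, ← mul_pow, mul_inv_cancel₀ hc, one_pow, C_1, one_mul] at this

lemma vI_pow_one {v : Fin 3 → ℂ} {F : Poly3} : F ∈ vI v ^ 1 ↔ eval v F = 0 := by
  rw [pow_one]; rfl
/-! ### Normal forms -/

def e3 : Fin 3 → ℂ := ![0, 0, 1]

lemma homog_sum {F : Poly3} {d : ℕ} (h : F.IsHomogeneous d) :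
    F = ∑ k ∈ Finset.Nat.antidiagonalTuple 3 d, monomial (toF k) (coeff (toF k) F) := by
  ext n
  rw [coeff_sum]
  simp only [coeff_monomial]
  have hinj : ∀ k : Fin 3 → ℕ, toF k = n ↔ k = n := by
    intro k
    constructor
    · rintro rfl; rfl
    · intro hk; ext i; simp [toF, hk]
  simp only [hinj]
  rw [Finset.sum_ite_eq']
  have hn : toF n = n := (hinj n).2 rfl
  split_ifs with hh
  · rw [hn]
  · apply h.coeff_eq_zero
    intro hd
    apply hh
    rw [Finset.Nat.mem_antidiagonalTuple, Fin.sum_univ_three, ← toF_degree, hn, hd]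

lemma coeff_zero_of_mem_e3 {G : Poly3} {d m : ℕ} (h : G.IsHomogeneous d) (hm : G ∈ vI e3 ^ m)
    (k : Fin 3 →₀ ℕ) (hk : k 0 + k 1 < m) : coeff k G = 0 := by
  classical
  by_cases hd : k.degree = d
  swap
  · exact h.coeff_eq_zero hd
  let ψ : Poly3 →ₐ[ℂ] Poly3 := aeval ![X 0, X 1, 1]
  have h1 : ψ G ∈ idealOfVars (Fin 3) ℂ ^ m := by
    refine map_vI_pow (ψ : Poly3 →+* Poly3) _ _ (fun G hG => ?_) hm
    rw [← pow_one (idealOfVars (Fin 3) ℂ), mem_pow_idealOfVars_iff']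
    intro x hx
    have : x = 0 := by
      rw [← Finsupp.degree_eq_zero_iff]; omega
    rw [this, ← constantCoeff_eq, ← eval_zero']
    refine Eq.trans ?_ hG
    have : (eval (0 : Fin 3 → ℂ)).comp (ψ : Poly3 →+* Poly3) = eval e3 := by
      apply MvPolynomial.ringHom_ext
      · intros; simp [ψ]
      · intro i; fin_cases i <;> simp [ψ, e3]
    exact DFunLike.congr_fun this G
  rw [mem_pow_idealOfVars_iff'] at h1
  have h2 := h1 (toF ![k 0, k 1, 0]) (by rw [toF_degree]; simpa using hk)
  have h3 : ∀ n : Fin 3 →₀ ℕ, ∀ c : ℂ, ψ (monomial n c) = monomial (toF ![n 0, n 1, 0]) c := by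
    intro n c
    rw [aeval_monomial, Finsupp.prod_fintype _ _ (by simp), Fin.prod_univ_three,
      monomial_eq, Finsupp.prod_fintype _ _ (by simp), Fin.prod_univ_three]
    simp [toF, algebraMap_eq]
  rw [G.as_sum, map_sum, coeff_sum] at h2
  simp only [h3, coeff_monomial] at h2
  rw [Finset.sum_eq_single k] at h2
  · simpa using h2
  · intro b hb hbk
    rw [if_neg]
    intro he
    apply hbk
    have hbd : b.degree = d := by
      by_contra hne
      exact (mem_support_iff.1 hb) (h.coeff_eq_zero hne)
    have t0 := DFunLike.congr_fun he 0
    have t1 := DFunLike.congr_fun he 1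
    simp [toF] at t0 t1
    have hb3 : b.degree = b 0 + b 1 + b 2 := by
      rw [← toF_degree]; congr 1; ext; simp [toF]
    have hk3 : k.degree = k 0 + k 1 + k 2 := by
      rw [← toF_degree]; congr 1; ext; simp [toF]
    ext i
    fin_cases i
    · exact t0
    · exact t1
    · show b 2 = k 2
      omega
  · intro hk
    simp [notMem_support_iff.1 hk]

/-- the normalized cubic -/
def ncub (α r1 r2 δ0 δ1 δ2 δ3 : ℂ) : Poly3 :=
  X 2 * (C α * (X 0 - C r1 * X 1) * (X 0 - C r2 * X 1)) +
    (C δ0 * X 0 ^ 3 + C δ1 * X 0 ^ 2 * X 1 + C δ2 * X 0 * X 1 ^ 2 + C δ3 * X 1 ^ 3)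

lemma cubic_form {A : Poly3} (h : A.IsHomogeneous 3) (h2 : A ∈ vI e3 ^ 2) :
    ∃ α β γ δ0 δ1 δ2 δ3 : ℂ, A = X 2 * (C α * X 0 ^ 2 + C β * X 0 * X 1 + C γ * X 1 ^ 2) +
    (C δ0 * X 0 ^ 3 + C δ1 * X 0 ^ 2 * X 1 + C δ2 * X 0 * X 1 ^ 2 + C δ3 * X 1 ^ 3) := by
  have e := homog_sum h
  rw [show Finset.Nat.antidiagonalTuple 3 3 = {![0,0,3], ![0,1,2], ![1,0,2], ![2,0,1], ![1,1,1],
    ![0,2,1], ![3,0,0], ![2,1,0], ![1,2,0], ![0,3,0]} from by decide] at e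
  have z1 := coeff_zero_of_mem_e3 h h2 (toF ![0,0,3]) (by simp [toF])
  have z2 := coeff_zero_of_mem_e3 h h2 (toF ![0,1,2]) (by simp [toF])
  have z3 := coeff_zero_of_mem_e3 h h2 (toF ![1,0,2]) (by simp [toF])
  have hmon : ∀ a b c : ℕ, ∀ t : ℂ, monomial (toF ![a,b,c]) t = C t * X 0 ^ a * X 1 ^ b * X 2 ^ c := by
    intro a b c t
    rw [monomial_eq, Finsupp.prod_fintype _ _ (by simp), Fin.prod_univ_three]
    simp [toF, mul_assoc]
  refine ⟨coeff (toF ![2,0,1]) A, coeff (toF ![1,1,1]) A, coeff (toF ![0,2,1]) A,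
    coeff (toF ![3,0,0]) A, coeff (toF ![2,1,0]) A, coeff (toF ![1,2,0]) A, coeff (toF ![0,3,0]) A, ?_⟩
  conv_lhs => rw [e]
  repeat rw [Finset.sum_insert (by decide)]
  rw [Finset.sum_singleton, z1, z2, z3]
  simp only [hmon, C_0]
  ring
/-! ### Bezout with a normalized nodal cubic -/

lemma lin_prime (r : ℂ) : Irreducible (X 0 - C r * X 1 : Poly3) := by
  have hom : (X 0 - C r * X 1 : Poly3).IsHomogeneous 1 :=
    (isHomogeneous_X _ _).sub (isHomogeneous_C_mul_X _ _)
  have hc : coeff (Finsupp.single 0 1) (X 0 - C r * X 1 : Poly3) = 1 := by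
    rw [coeff_sub, coeff_C_mul]
    rw [coeff_X, coeff_X, if_pos rfl, if_neg]
    · simp
    · intro h
      have := DFunLike.congr_fun h 0
      simp at this
  have h0 : (X 0 - C r * X 1 : Poly3) ≠ 0 := by
    intro h
    rw [h] at hc
    simp at hc
  apply irreducible_of_totalDegree_eq_one (hom.totalDegree h0)
  intro x hx
  have := hx (Finsupp.single 0 1)
  rw [hc] at this
  exact isUnit_of_dvd_one this

lemma strip {A L G : Poly3} (hL : Irreducible L) (hA : ¬ L ∣ A) (n : ℕ) (h : A ∣ L ^ n * G) :
    A ∣ G := by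
  have h1 : IsRelPrime L A := (hL.isRelPrime_iff_not_dvd).2 hA
  exact (h1.symm.pow_right).dvd_of_dvd_mul_left h

lemma eval_aeval' (v : Fin 3 → ℂ) (g : Fin 3 → Poly3) (F : Poly3) :
    eval v (aeval g F) = eval (fun i => eval v (g i)) F := by
  have : (eval v).comp (aeval g : Poly3 →ₐ[ℂ] Poly3).toRingHom = eval (fun i => eval v (g i)) := by
    apply MvPolynomial.ringHom_ext <;> intros <;> simp
  exact DFunLike.congr_fun this F

lemma peval_aeval (t : ℂ) (g : Fin 3 → Polynomial ℂ) (F : Poly3) :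
    Polynomial.eval t (aeval g F) = eval (fun i => Polynomial.eval t (g i)) F := by
  have : (Polynomial.evalRingHom t).comp (aeval g : Poly3 →ₐ[ℂ] Polynomial ℂ).toRingHom =
      eval (fun i => Polynomial.eval t (g i)) := by
    apply MvPolynomial.ringHom_ext <;> intros <;> simp
  exact DFunLike.congr_fun this F

lemma lin_dvd_of (r : ℂ) (A : Poly3) (h : ∀ y z, eval ![r * y, y, z] A = 0) :
    (X 0 - C r * X 1 : Poly3) ∣ A := by
  have h0 : aeval ![C r * X 1, X 1, X 2] A = (0 : Poly3) := by
    apply MvPolynomial.funext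
    intro v
    rw [eval_aeval', map_zero, ← h (v 1) (v 2)]
    congr 2
    funext i
    fin_cases i <;> simp
  rw [← Ideal.mem_span_singleton, ← Ideal.Quotient.eq_zero_iff_mem]
  set J : Ideal Poly3 := Ideal.span {(X 0 - C r * X 1 : Poly3)}
  have e2 : (Ideal.Quotient.mkₐ ℂ J).comp (AlgHom.id ℂ Poly3) =
          (Ideal.Quotient.mkₐ ℂ J).comp (aeval ![C r * X 1, X 1, X 2]) := by
    apply MvPolynomial.algHom_ext
    intro i
    fin_cases i
    · simp only [AlgHom.comp_apply, aeval_X, Ideal.Quotient.mkₐ_eq_mk]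
      rw [Ideal.Quotient.eq, Ideal.mem_span_singleton]
      exact dvd_rfl
    · simp
    · simp
  have := DFunLike.congr_fun e2 A
  simp only [AlgHom.comp_apply, h0, map_zero] at this
  exact this

lemma mod_lemma (q3 c3 A G : Poly3) (hAqc : A = X 2 * q3 + c3)
    (hR3 : aeval ![X 0 * q3, X 1 * q3, -c3] G = 0) : A ∣ aeval (fun i => q3 * X i) G := by
  rw [← Ideal.mem_span_singleton, ← Ideal.Quotient.eq_zero_iff_mem]
  have e2 : (Ideal.Quotient.mkₐ ℂ (Ideal.span {A})).comp (aeval (fun i => q3 * X i)) =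
      (Ideal.Quotient.mkₐ ℂ (Ideal.span {A})).comp (aeval ![X 0 * q3, X 1 * q3, -c3]) := by
    apply MvPolynomial.algHom_ext
    intro i
    simp only [AlgHom.comp_apply, aeval_X]
    fin_cases i
    · show (Ideal.Quotient.mkₐ ℂ (Ideal.span {A})) (q3 * X 0) = (Ideal.Quotient.mkₐ ℂ (Ideal.span {A})) (X 0 * q3)
      rw [mul_comm]
    · show (Ideal.Quotient.mkₐ ℂ (Ideal.span {A})) (q3 * X 1) = (Ideal.Quotient.mkₐ ℂ (Ideal.span {A})) (X 1 * q3)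
      rw [mul_comm]
    · simp only [Ideal.Quotient.mkₐ_eq_mk]
      rw [Ideal.Quotient.eq, Ideal.mem_span_singleton]
      refine dvd_of_eq ?_
      show A = q3 * X 2 - - c3
      rw [hAqc]; ring
  have e1 := DFunLike.congr_fun e2 G
  simp only [AlgHom.comp_apply] at e1
  rw [hR3, map_zero] at e1
  exact e1

set_option maxHeartbeats 1000000 in
lemma nodal_bezout {ι : Type*} (K : Finset ι) {α r1 r2 δ0 δ1 δ2 δ3 : ℂ} (hα : α ≠ 0)
    (hA : ∀ r : ℂ, ¬ (X 0 - C r * X 1 : Poly3) ∣ ncub α r1 r2 δ0 δ1 δ2 δ3)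
    {G : Poly3} {d m : ℕ} (hG : G.IsHomogeneous d) (hm : G ∈ vI e3 ^ m)
    (s w : ι → ℂ) (n : ι → ℕ) (hs : Set.InjOn s K)
    (hAs : ∀ k ∈ K, eval ![s k, 1, w k] (ncub α r1 r2 δ0 δ1 δ2 δ3) = 0)
    (hGs : ∀ k ∈ K, G ∈ vI ![s k, 1, w k] ^ n k)
    (hbig : 3 * d < 2 * m + ∑ k ∈ K, n k) :
    ncub α r1 r2 δ0 δ1 δ2 δ3 ∣ G := by
  classical
  set A := ncub α r1 r2 δ0 δ1 δ2 δ3 with hAdef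
  -- univariate data
  let q : Polynomial ℂ := Polynomial.C α * (Polynomial.X - Polynomial.C r1) *
    (Polynomial.X - Polynomial.C r2)
  let c : Polynomial ℂ := Polynomial.C δ0 * Polynomial.X ^ 3 + Polynomial.C δ1 * Polynomial.X ^ 2 +
    Polynomial.C δ2 * Polynomial.X + Polynomial.C δ3
  let φ : Poly3 →ₐ[ℂ] Polynomial ℂ := aeval ![Polynomial.X * q, q, -c]
  have hq2 : q.natDegree = 2 := by
    simp only [q]
    rw [Polynomial.natDegree_mul, Polynomial.natDegree_mul] <;>
      simp [Polynomial.X_sub_C_ne_zero, hα]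
  have hq0 : q ≠ 0 := by
    intro h
    rw [h] at hq2
    simp at hq2
  have hc3 : c.natDegree ≤ 3 := by
    simp only [c]
    compute_degree
  have hdeg : (φ G).natDegree ≤ d * 3 := by
    apply aeval_natDegree_le _ hG.totalDegree_le
    intro i
    fin_cases i
    · show (Polynomial.X * q).natDegree ≤ 3
      refine (Polynomial.natDegree_mul_le).trans ?_
      rw [hq2]; simp
    · show q.natDegree ≤ 3
      omega
    · show (-c).natDegree ≤ 3
      rwa [Polynomial.natDegree_neg]
  have hqm : q ^ m ∣ φ G := by
    rw [G.as_sum, map_sum]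
    apply Finset.dvd_sum
    intro k hk
    have hk' : m ≤ k 0 + k 1 := by
      by_contra hlt
      exact (mem_support_iff.1 hk) (coeff_zero_of_mem_e3 hG hm k (by omega))
    rw [aeval_monomial, Finsupp.prod_fintype _ _ (by simp), Fin.prod_univ_three]
    refine Dvd.dvd.mul_left (Dvd.dvd.mul_right ?_ _) _
    show q ^ m ∣ (Polynomial.X * q) ^ (k 0) * q ^ (k 1)
    rw [mul_pow Polynomial.X q, mul_assoc, ← pow_add]
    exact Dvd.dvd.mul_left (pow_dvd_pow _ hk') _
  have hev : ∀ (k : ι) , k ∈ K → q.eval (s k) * w k + c.eval (s k) = 0 := by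
    intro k hk
    have := hAs k hk
    simp only [hAdef, ncub] at this
    simp at this
    simp only [q, c]
    simp
    linear_combination this
  have hqs : ∀ k ∈ K, q.eval (s k) ≠ 0 := by
    intro k hk h0
    have h1 := hev k hk
    rw [h0, zero_mul, zero_add] at h1
    apply hA (s k)
    apply lin_dvd_of
    intro y z
    simp only [hAdef, ncub]
    simp [q] at h0
    simp [c] at h1
    simp
    have h0' : α * (s k - r1) * (s k - r2) = 0 := by simpa using h0
    linear_combination z * y ^ 2 * h0' + y ^ 3 * h1
  have hpow : ∀ k ∈ K, (Polynomial.X - Polynomial.C (s k)) ^ n k ∣ φ G := by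
    intro k hk
    rw [← Ideal.mem_span_singleton, ← Ideal.span_singleton_pow]
    have hG' := smul_mem_vI hG (hqs k hk) (hGs k hk)
    refine map_vI_pow (φ : Poly3 →+* Polynomial ℂ) _ _ (fun H hH => ?_) hG'
    rw [Ideal.mem_span_singleton, Polynomial.dvd_iff_isRoot, Polynomial.IsRoot.def]
    refine Eq.trans ?_ hH
    refine (peval_aeval _ _ _).trans ?_
    congr 2
    funext i
    have := hev k hk
    fin_cases i
    · simp [mul_comm]
    · simp
    · simp
      linear_combination -this
  have hR : φ G = 0 := by
    by_contra hne
    have hdvd : q ^ m * ∏ k ∈ K, (Polynomial.X - Polynomial.C (s k)) ^ n k ∣ φ G := by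
      apply IsCoprime.mul_dvd _ hqm
      · apply Finset.prod_dvd_of_coprime _ hpow
        intro a ha b hb hab
        apply IsCoprime.pow
        apply Polynomial.isCoprime_X_sub_C_of_isUnit_sub
        rw [isUnit_iff_ne_zero, sub_ne_zero]
        exact fun h => hab (hs ha hb h)
      · apply IsCoprime.prod_right
        intro k hk
        apply IsCoprime.pow
        apply IsCoprime.symm
        rw [(Polynomial.irreducible_X_sub_C (s k)).coprime_iff_not_dvd, Polynomial.dvd_iff_isRoot]
        exact hqs k hk
    have := Polynomial.natDegree_le_of_dvd hdvd hne
    rw [Polynomial.natDegree_mul (pow_ne_zero _ hq0) (Finset.prod_ne_zero_iff.2 fun k _ =>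
      pow_ne_zero _ (Polynomial.X_sub_C_ne_zero _)), Polynomial.natDegree_pow, hq2,
      Polynomial.natDegree_prod _ _ (fun k _ => pow_ne_zero _ (Polynomial.X_sub_C_ne_zero _))] at this
    simp at this
    omega
  -- back to three variables
  let q3 : Poly3 := C α * (X 0 - C r1 * X 1) * (X 0 - C r2 * X 1)
  let c3 : Poly3 := C δ0 * X 0 ^ 3 + C δ1 * X 0 ^ 2 * X 1 + C δ2 * X 0 * X 1 ^ 2 + C δ3 * X 1 ^ 3
  have hAqc : A = X 2 * q3 + c3 := rfl
  let R3 : Poly3 := aeval ![X 0 * q3, X 1 * q3, -c3] G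
  have hR3 : R3 = 0 := by
    have : X 1 * R3 = 0 := by
      apply MvPolynomial.funext
      intro v
      by_cases hv : v 1 = 0
      · simp [hv]
      · rw [eval_mul, eval_aeval']
        have e : (fun i => eval v ((![X 0 * q3, X 1 * q3, -c3] : Fin 3 → Poly3) i)) =
            (v 1 ^ 3) • fun i => Polynomial.eval (v 0 / v 1)
              ((![Polynomial.X * q, q, -c] : Fin 3 → Polynomial ℂ) i) := by
          funext i
          fin_cases i
          · simp [q3, q]; field_simp
          · simp [q3, q]; field_simp
          · simp [c3, c]; field_simp
        rw [e, homog_eval_smul hG, ← peval_aeval]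
        change _ * (_ * Polynomial.eval _ (φ G)) = _
        rw [hR]; simp
    exact (mul_eq_zero.1 this).resolve_left (X_ne_zero _)
  have hqG : q3 ^ d * G = aeval (fun i => q3 * X i) G := by
    rw [homog_aeval_smul hG q3 X, aeval_X_left_apply]
  have hdvd : A ∣ q3 ^ d * G := by
    rw [hqG]
    exact mod_lemma q3 c3 A G hAqc hR3
  have hfin : q3 ^ d * G = (X 0 - C r1 * X 1) ^ d * ((X 0 - C r2 * X 1) ^ d * (C (α ^ d) * G)) := by
    simp only [q3, C_pow, mul_pow]
    ring
  rw [hfin] at hdvd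
  have h3 := strip (lin_prime r2) (hA r2) d (strip (lin_prime r1) (hA r1) d hdvd)
  have hu : IsUnit (C (α ^ d) : Poly3) := (isUnit_iff_ne_zero.2 (pow_ne_zero _ hα)).map C
  exact (hu.dvd_mul_left).1 h3

/-! ### Existence by dimension count -/

lemma mulVec_e3 (M : Matrix (Fin 3) (Fin 3) ℂ) : M.mulVec e3 = fun i => M i 2 := by
  funext i
  simp [Matrix.mulVec, dotProduct, Fin.sum_univ_three, e3]

lemma exists_mat {v : Fin 3 → ℂ} (hv : v ≠ 0) :
    ∃ M : Matrix (Fin 3) (Fin 3) ℂ, IsUnit M.det ∧ M.mulVec e3 = v := by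
  obtain ⟨i, hi⟩ := Function.ne_iff.1 hv
  have hi' : v i ≠ 0 := hi
  have hc : i = 0 ∨ i = 1 ∨ i = 2 := by fin_cases i <;> simp
  rcases hc with rfl | rfl | rfl
  · refine ⟨!![0,0,v 0;1,0,v 1;0,1,v 2], ?_, ?_⟩
    · rw [isUnit_iff_ne_zero, Matrix.det_fin_three]; simpa using hi'
    · rw [mulVec_e3]; funext j; fin_cases j <;> simp
  · refine ⟨!![1,0,v 0;0,0,v 1;0,1,v 2], ?_, ?_⟩
    · rw [isUnit_iff_ne_zero, Matrix.det_fin_three]; simpa using hi'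
    · rw [mulVec_e3]; funext j; fin_cases j <;> simp
  · refine ⟨!![1,0,v 0;0,1,v 1;0,0,v 2], ?_, ?_⟩
    · rw [isUnit_iff_ne_zero, Matrix.det_fin_three]; simpa using hi'
    · rw [mulVec_e3]; funext j; fin_cases j <;> simp

lemma mem_e3_of_coeff {G : Poly3} {m : ℕ}
    (hk : ∀ k : Fin 3 →₀ ℕ, k 0 + k 1 < m → coeff k G = 0) : G ∈ vI e3 ^ m := by
  rw [G.as_sum]
  apply Ideal.sum_mem
  intro k hks
  have hkm : m ≤ k 0 + k 1 := by
    by_contra hlt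
    exact (mem_support_iff.1 hks) (hk k (by omega))
  rw [monomial_eq, Finsupp.prod_fintype _ _ (by simp), Fin.prod_univ_three]
  apply Ideal.mul_mem_left
  apply Ideal.mul_mem_right
  refine Ideal.pow_le_pow_right hkm ?_
  rw [pow_add]
  apply Ideal.mul_mem_mul <;> apply Ideal.pow_mem_pow
  · show eval e3 (X 0) = 0
    simp [e3]
  · show eval e3 (X 1) = 0
    simp [e3]

/-- index set for vanishing conditions -/
def TT (m : ℕ) : Finset (ℕ × ℕ) := (Finset.range m ×ˢ Finset.range m).filter fun p => p.1 + p.2 < m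

/-- homogeneous polynomial with given coefficients -/
def hpoly (d : ℕ) : (Finset.Nat.antidiagonalTuple 3 d → ℂ) →ₗ[ℂ] Poly3 where
  toFun c := ∑ k, monomial (toF k.1) (c k)
  map_add' a b := by simp [Finset.sum_add_distrib]
  map_smul' a b := by simp [Finset.smul_sum, smul_monomial]

lemma hpoly_homog (d : ℕ) (c) : (hpoly d c).IsHomogeneous d := by
  apply IsHomogeneous.sum
  intro k _
  apply isHomogeneous_monomial
  rw [toF_degree, ← Fin.sum_univ_three]
  exact Finset.Nat.mem_antidiagonalTuple.1 k.2

lemma toF_inj {k l : Fin 3 → ℕ} (h : toF k = toF l) : k = l :=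
  Finsupp.equivFunOnFinite.symm.injective h

lemma hpoly_inj (d : ℕ) (c) (h : hpoly d c = 0) : c = 0 := by
  classical
  funext k
  have h1 : coeff (toF k.1) (hpoly d c) = 0 := by rw [h]; simp
  have : hpoly d c = ∑ k, monomial (toF k.1) (c k) := rfl
  rw [this, coeff_sum, Finset.sum_eq_single k] at h1
  · simpa using h1
  · intro b _ hb
    rw [coeff_monomial, if_neg]
    intro he
    exact hb (Subtype.ext (toF_inj he))
  · simp

lemma exists_curve {ι : Type} [Fintype ι] (v : ι → Fin 3 → ℂ) (hv : ∀ k, v k ≠ 0) (m : ι → ℕ) (d : ℕ)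
    (hc : ∑ k, (TT (m k)).card < (Finset.Nat.antidiagonalTuple 3 d).card) :
    ∃ F : Poly3, F ≠ 0 ∧ F.IsHomogeneous d ∧ ∀ k, F ∈ vI (v k) ^ m k := by
  choose M hM hMv using fun k => exists_mat (hv k)
  let Φ : (Finset.Nat.antidiagonalTuple 3 d → ℂ) →ₗ[ℂ] ((Σ k : ι, (TT (m k))) → ℂ) :=
    LinearMap.pi fun x => (lcoeff ℂ (toF ![x.2.1.1, x.2.1.2, d - x.2.1.1 - x.2.1.2])).comp
      ((lsub (M x.1)).toLinearMap.comp (hpoly d))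
  have hker : LinearMap.ker Φ ≠ ⊥ := by
    apply LinearMap.ker_ne_bot_of_finrank_lt
    simpa using hc
  obtain ⟨c, hcΦ, hc0⟩ := (Submodule.ne_bot_iff _).1 hker
  refine ⟨hpoly d c, fun h => hc0 (hpoly_inj d c h), hpoly_homog d c, fun k => ?_⟩
  have h1 : lsub (M k) (hpoly d c) ∈ vI e3 ^ m k := by
    apply mem_e3_of_coeff
    intro a ha
    by_cases had : a.degree = d
    swap
    · exact (lsub_homog (M k) (hpoly_homog d c)).coeff_eq_zero had
    have h2 := congrFun (LinearMap.mem_ker.1 hcΦ) ⟨k, ⟨(a 0, a 1), by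
      simp [TT]; omega⟩⟩
    have h3 : toF ![a 0, a 1, d - a 0 - a 1] = a := by
      have : a.degree = a 0 + a 1 + a 2 := by
        rw [← toF_degree]; congr 1; ext; simp [toF]
      ext i
      fin_cases i
      · simp [toF]
      · simp [toF]
      · simp [toF]; omega
    rw [← h3]
    exact h2
  have h4 := lsub_lsub (M k) (M k)⁻¹ (Matrix.mul_nonsing_inv _ (hM k)) (hpoly d c)
  rw [← h4]
  apply lsub_mem
  rw [← hMv k, Matrix.mulVec_mulVec, Matrix.nonsing_inv_mul _ (hM k), Matrix.one_mulVec]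
  exact h1

/-! ### General position, coordinates -/

/-- General position for eight vectors. -/
structure GP (v : Fin 8 → Fin 3 → ℂ) : Prop where
  ne0 : ∀ k, v k ≠ 0
  lin : ∀ a b c, a ≠ b → a ≠ c → b ≠ c → ∀ L : Poly3, L ≠ 0 → L.IsHomogeneous 1 →
    eval (v a) L = 0 → eval (v b) L = 0 → eval (v c) L = 0 → False
  con : ∀ a b, ∀ Q : Poly3, Q ≠ 0 → Q.IsHomogeneous 2 →
    (∀ k, k ≠ a → k ≠ b → eval (v k) Q = 0) → False
  cub : ∀ F : Poly3, F ≠ 0 → F.IsHomogeneous 3 → (∀ k, eval (v k) F = 0) →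
    ∀ i, F ∈ vI (v i) ^ 2 → False

/-- determinant -/
def det3 (a b c : Fin 3 → ℂ) : ℂ :=
  a 0 * (b 1 * c 2 - b 2 * c 1) + a 1 * (b 2 * c 0 - b 0 * c 2) + a 2 * (b 0 * c 1 - b 1 * c 0)

/-- linear form `det (-, b, c)` -/
def Ld (b c : Fin 3 → ℂ) : Poly3 :=
  C (b 1 * c 2 - b 2 * c 1) * X 0 + C (b 2 * c 0 - b 0 * c 2) * X 1 + C (b 0 * c 1 - b 1 * c 0) * X 2

lemma eval_Ld (a b c : Fin 3 → ℂ) : eval a (Ld b c) = det3 a b c := by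
  simp [Ld, det3]; ring

/-- matrix with given columns -/
def colM (a b c : Fin 3 → ℂ) : Matrix (Fin 3) (Fin 3) ℂ :=
  !![a 0, b 0, c 0; a 1, b 1, c 1; a 2, b 2, c 2]

lemma det_colM (a b c : Fin 3 → ℂ) : (colM a b c).det = det3 a b c := by
  simp [colM, det3, Matrix.det_fin_three]; ring

lemma colM_mulVec (a b c x : Fin 3 → ℂ) : (colM a b c).mulVec x = x 0 • a + x 1 • b + x 2 • c := by
  funext i
  fin_cases i <;> simp [colM, Matrix.mulVec, dotProduct, Fin.sum_univ_three] <;> ring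

lemma det3_mulVec (M : Matrix (Fin 3) (Fin 3) ℂ) (a b c : Fin 3 → ℂ) :
    det3 (M.mulVec a) (M.mulVec b) (M.mulVec c) = M.det * det3 a b c := by
  simp [det3, Matrix.mulVec, dotProduct, Fin.sum_univ_three, Matrix.det_fin_three]; ring

lemma homog_lin (w : Fin 3 → ℂ) : (∑ i, C (w i) * X i : Poly3).IsHomogeneous 1 := by
  apply IsHomogeneous.sum
  intro i _
  simpa using (isHomogeneous_C (Fin 3) (w i)).mul (isHomogeneous_X ℂ i)

lemma GP.det_ne {v : Fin 8 → Fin 3 → ℂ} (h : GP v) {a b c : Fin 8} (hab : a ≠ b) (hac : a ≠ c)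
    (hbc : b ≠ c) : det3 (v a) (v b) (v c) ≠ 0 := by
  intro h0
  have h1 : (Matrix.transpose (colM (v a) (v b) (v c))).det = 0 := by
    rw [Matrix.det_transpose, det_colM, h0]
  obtain ⟨w, hw, hw0⟩ := Matrix.exists_mulVec_eq_zero_iff.2 h1
  have e0 := congrFun hw0 0
  have e1 := congrFun hw0 1
  have e2 := congrFun hw0 2
  simp [colM, Matrix.mulVec, dotProduct, Fin.sum_univ_three] at e0 e1 e2
  refine h.lin a b c hab hac hbc (∑ i, C (w i) * X i) ?_ (homog_lin w) ?_ ?_ ?_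
  · intro hL
    apply hw
    funext i
    have := congrArg (eval (Pi.single i 1)) hL
    simpa [Pi.single_apply] using this
  all_goals simp [Fin.sum_univ_three]
  · linear_combination e0
  · linear_combination e1
  · linear_combination e2

lemma lsub_dvd {M : Matrix (Fin 3) (Fin 3) ℂ} (hM : IsUnit M.det) {F G : Poly3}
    (h : lsub M F ∣ lsub M G) : F ∣ G := by
  have := map_dvd (lsub M⁻¹) h
  rwa [lsub_lsub M M⁻¹ (Matrix.mul_nonsing_inv _ hM), lsub_lsub M M⁻¹ (Matrix.mul_nonsing_inv _ hM)] at this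

lemma lsub_ne_zero {M : Matrix (Fin 3) (Fin 3) ℂ} (hM : IsUnit M.det) {F : Poly3}
    (h : F ≠ 0) : lsub M F ≠ 0 := by
  intro h0
  apply h
  rw [← lsub_lsub M M⁻¹ (Matrix.mul_nonsing_inv _ hM) F, h0, map_zero]

lemma homog_top_mult {G : Poly3} {d : ℕ} (h : G.IsHomogeneous d) {v : Fin 3 → ℂ} (hv : v ≠ 0)
    (hm : G ∈ vI v ^ (d + 1)) : G = 0 := by
  obtain ⟨M, hM, hMv⟩ := exists_mat hv
  rw [← hMv] at hm
  have h1 := lsub_mem M hm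
  have hh := lsub_homog M h
  by_contra h0
  apply lsub_ne_zero hM h0
  ext k
  by_cases hk : k.degree = d
  · apply coeff_zero_of_mem_e3 hh h1
    have : k.degree = k 0 + k 1 + k 2 := by
      rw [← toF_degree]; congr 1; ext; simp [toF]
    omega
  · exact hh.coeff_eq_zero hk

lemma GP.nlf {v : Fin 8 → Fin 3 → ℂ} (h : GP v) {A : Poly3} (hA0 : A ≠ 0) (hA : A.IsHomogeneous 3)
    {i j : Fin 8} (h2 : A ∈ vI (v i) ^ 2) (h1 : ∀ k, k ≠ j → eval (v k) A = 0)
    {L : Poly3} (hL : L.IsHomogeneous 1) (hLi : eval (v i) L = 0) (hdvd : L ∣ A) : False := by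
  obtain ⟨Q, rfl⟩ := hdvd
  have hL0 : L ≠ 0 := left_ne_zero_of_mul hA0
  have hQ0 : Q ≠ 0 := right_ne_zero_of_mul hA0
  obtain ⟨a, b, hab, ha, hb⟩ := homog_factors hA hA0
  have : a = 1 := ha.inj_right hL hL0
  have hb2 : b = 2 := by omega
  subst hb2
  have hQi : eval (v i) Q = 0 := by
    rw [← vI_pow_one, ← le_vm_iff hQ0]
    rw [← le_vm_iff hA0, vm_mul hL0 hQ0] at h2
    have : ¬ 2 ≤ vm (v i) L := by
      rw [le_vm_iff hL0]
      intro hm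
      exact hL0 (homog_top_mult hL (h.ne0 i) hm)
    omega
  by_cases hex : ∃ k0, k0 ≠ i ∧ eval (v k0) L = 0
  · obtain ⟨k0, hk0, hk0L⟩ := hex
    apply h.con j k0 Q hQ0 hb
    intro k hkj hkk
    by_cases hki : k = i
    · rw [hki, hQi]
    · have := h1 k hkj
      rw [eval_mul] at this
      rcases mul_eq_zero.1 this with h3 | h3
      · exact (h.lin i k0 k hk0.symm (Ne.symm hki) hkk.symm L hL0 hL hLi hk0L h3).elim
      · exact h3
  · push Not at hex
    apply h.con j j Q hQ0 hb
    intro k hkj _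
    by_cases hki : k = i
    · rw [hki, hQi]
    · have := h1 k hkj
      rw [eval_mul] at this
      exact (mul_eq_zero.1 this).resolve_left (hex k hki)

lemma lin_transport {v : Fin 8 → Fin 3 → ℂ} (h : GP v) {A : Poly3} (hA0 : A ≠ 0) (hA : A.IsHomogeneous 3)
    {i j : Fin 8} (h2 : A ∈ vI (v i) ^ 2) (h1 : ∀ k, k ≠ j → eval (v k) A = 0)
    {M : Matrix (Fin 3) (Fin 3) ℂ} (hM : IsUnit M.det) (hMi : M.mulVec e3 = v i) (r : ℂ) :
    ¬ (X 0 - C r * X 1 : Poly3) ∣ lsub M A := by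
  intro hd
  have hl := lsub_lsub M⁻¹ M (Matrix.nonsing_inv_mul _ hM) (X 0 - C r * X 1)
  rw [← hl] at hd
  refine h.nlf hA0 hA h2 h1 (lsub_homog M⁻¹ ?_) ?_ (lsub_dvd hM hd)
  · refine (isHomogeneous_X ℂ _).sub ?_
    simpa using (isHomogeneous_C (Fin 3) r).mul (isHomogeneous_X ℂ (1 : Fin 3))
  · rw [eval_lsub, ← hMi, Matrix.mulVec_mulVec, Matrix.nonsing_inv_mul _ hM, Matrix.one_mulVec]
    simp [e3]

lemma exists_two (i j : Fin 8) : ∃ k l : Fin 8, k ≠ i ∧ k ≠ j ∧ l ≠ i ∧ l ≠ j ∧ k ≠ l := by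
  revert i j; decide

lemma qt_ne {v : Fin 8 → Fin 3 → ℂ} (h : GP v) {A : Poly3} (hA0 : A ≠ 0) (hA : A.IsHomogeneous 3)
    {i j : Fin 8} (h2 : A ∈ vI (v i) ^ 2) (h1 : ∀ k, k ≠ j → eval (v k) A = 0) :
    trl (v i) A - A ≠ 0 := by
  intro h0
  obtain ⟨k, l, hki, hkj, hli, hlj, hkl⟩ := exists_two i j
  have hM : IsUnit (colM (v l) (v k) (v i)).det := by
    rw [det_colM, isUnit_iff_ne_zero]
    exact h.det_ne hkl.symm hli hki
  have hMi : (colM (v l) (v k) (v i)).mulVec e3 = v i := by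
    rw [colM_mulVec]; simp [e3]
  apply lin_transport h hA0 hA h2 h1 hM hMi 0
  apply lin_dvd_of
  rw [← hMi] at h2
  obtain ⟨α, β, γ, δ0, δ1, δ2, δ3, hf⟩ := cubic_form (lsub_homog _ hA) (lsub_mem _ h2)
  have a1 : eval ![0,1,0] (lsub (colM (v l) (v k) (v i)) A) = 0 := by
    rw [eval_lsub, colM_mulVec]
    simpa using h1 k hkj
  have a2 : eval ![0,1,1] (lsub (colM (v l) (v k) (v i)) A) =
      eval ![0,1,0] (lsub (colM (v l) (v k) (v i)) A) := by
    rw [eval_lsub, colM_mulVec, eval_lsub, colM_mulVec]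
    have := congrArg (eval (v k)) h0
    rw [map_sub, eval_trl, map_zero] at this
    simp
    linear_combination this
  rw [a1] at a2
  rw [hf] at a1 a2 ⊢
  simp at a1 a2
  intro y z
  simp
  linear_combination (y ^ 3 - z * y ^ 2) * a1 + z * y ^ 2 * a2

lemma quad_factor {α : ℂ} (hα : α ≠ 0) (β γ : ℂ) : ∃ r1 r2 : ℂ, β = - α * (r1 + r2) ∧ γ = α * (r1 * r2) := by
  obtain ⟨t, ht⟩ := IsAlgClosed.exists_pow_nat_eq (β ^ 2 - 4 * α * γ) (n := 2) (by norm_num)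
  refine ⟨(-β + t) / (2 * α), (-β - t) / (2 * α), ?_, ?_⟩
  · field_simp; ring
  · field_simp; linear_combination ht

lemma coords {v : Fin 8 → Fin 3 → ℂ} (h : GP v) {A : Poly3} (hA0 : A ≠ 0) (hA : A.IsHomogeneous 3)
    {i j : Fin 8} (h2 : A ∈ vI (v i) ^ 2) (h1 : ∀ k, k ≠ j → eval (v k) A = 0) :
    ∃ (M : Matrix (Fin 3) (Fin 3) ℂ) (α r1 r2 δ0 δ1 δ2 δ3 : ℂ) (s w c : Fin 8 → ℂ),
      IsUnit M.det ∧ M.mulVec e3 = v i ∧ α ≠ 0 ∧ lsub M A = ncub α r1 r2 δ0 δ1 δ2 δ3 ∧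
      (∀ k, k ≠ i → c k ≠ 0 ∧ M.mulVec ![s k, 1, w k] = c k • v k) ∧
      (∀ k l, k ≠ i → l ≠ i → s k = s l → k = l) := by
  have hP : (∏ k ∈ Finset.univ.erase i, Ld (v k) (v i)) * (trl (v i) A - A) ≠ 0 := by
    refine mul_ne_zero (Finset.prod_ne_zero_iff.2 fun k hk h0 => ?_) (qt_ne h hA0 hA h2 h1)
    have hki := Finset.ne_of_mem_erase hk
    obtain ⟨l, _, hli, hlk, _⟩ := exists_two i k
    apply h.det_ne hlk hli hki
    rw [← eval_Ld, h0, map_zero]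
  obtain ⟨e, he⟩ : ∃ e, eval e ((∏ k ∈ Finset.univ.erase i, Ld (v k) (v i)) * (trl (v i) A - A)) ≠ 0 := by
    by_contra hcon
    push Not at hcon
    exact hP (MvPolynomial.funext fun x => by rw [hcon x, map_zero])
  rw [eval_mul, map_prod] at he
  have hα' := right_ne_zero_of_mul he
  have hd : ∀ k, k ≠ i → det3 e (v k) (v i) ≠ 0 := by
    intro k hk
    rw [← eval_Ld]
    exact Finset.prod_ne_zero_iff.1 (left_ne_zero_of_mul he) k (Finset.mem_erase.2 ⟨hk, Finset.mem_univ _⟩)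
  obtain ⟨f, _, hfi, -⟩ := exists_two i i
  set M := colM e (v f) (v i) with hMdef
  have hM : IsUnit M.det := by
    rw [hMdef, det_colM, isUnit_iff_ne_zero]; exact hd f hfi
  have hMi : M.mulVec e3 = v i := by
    rw [hMdef, colM_mulVec]; simp [e3]
  have hMe : M.mulVec ![1,0,0] = e := by
    rw [hMdef, colM_mulVec]; simp
  let u : Fin 8 → Fin 3 → ℂ := fun k => M⁻¹.mulVec (v k)
  have hu : ∀ k, M.mulVec (u k) = v k := by
    intro k
    rw [Matrix.mulVec_mulVec, Matrix.mul_nonsing_inv _ hM, Matrix.one_mulVec]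
  have hu1 : ∀ k, k ≠ i → u k 1 ≠ 0 := by
    intro k hk h0
    apply hd k hk
    rw [← hMe, ← hMi, ← hu k, det3_mulVec]
    simp [det3, e3, h0]
  rw [← hMi] at h2
  obtain ⟨α, β, γ, δ0, δ1, δ2, δ3, hf⟩ := cubic_form (lsub_homog _ hA) (lsub_mem _ h2)
  have hα : α ≠ 0 := by
    intro h0
    apply hα'
    rw [map_sub, eval_trl]
    have b1 : M.mulVec ![1,0,1] = e + v i := by
      rw [hMdef, colM_mulVec]; simp
    rw [← b1, ← hMe, ← eval_lsub, ← eval_lsub, hf]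
    simp [h0]
  obtain ⟨r1, r2, hβ, hγ⟩ := quad_factor hα β γ
  refine ⟨M, α, r1, r2, δ0, δ1, δ2, δ3, fun k => u k 0 / u k 1, fun k => u k 2 / u k 1,
    fun k => (u k 1)⁻¹, hM, hMi, hα, ?_, ?_, ?_⟩
  · rw [hf, ncub, hβ, hγ]
    simp only [C_mul, C_neg, C_add]
    ring
  · intro k hk
    refine ⟨inv_ne_zero (hu1 k hk), ?_⟩
    conv_rhs => rw [← hu k]
    rw [← Matrix.mulVec_smul]
    congr 1
    have := hu1 k hk
    funext t
    fin_cases t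
    · simp; field_simp
    · simp [this]
    · simp; field_simp
  · intro k l hk hl hs
    by_contra hkl
    apply h.det_ne hkl hk hl
    have n1 := hu1 k hk
    have n2 := hu1 l hl
    simp only at hs
    field_simp at hs
    rw [← hMi, ← hu k, ← hu l, det3_mulVec]
    simp only [det3, e3]
    simp
    right
    linear_combination hs

lemma A_dvd {v : Fin 8 → Fin 3 → ℂ} (h : GP v) {A : Poly3} (hA0 : A ≠ 0) (hA : A.IsHomogeneous 3)
    {i j : Fin 8} (h2 : A ∈ vI (v i) ^ 2) (h1 : ∀ k, k ≠ j → eval (v k) A = 0)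
    {G : Poly3} (hG0 : G ≠ 0) {d : ℕ} (hG : G.IsHomogeneous d)
    (hbig : 3 * d < 2 * vm (v i) G + ∑ k ∈ (Finset.univ.erase i).erase j, vm (v k) G) : A ∣ G := by
  obtain ⟨M, α, r1, r2, δ0, δ1, δ2, δ3, s, w, c, hM, hMi, hα, hf, hc, hs⟩ := coords h hA0 hA h2 h1
  apply lsub_dvd hM
  rw [hf]
  refine nodal_bezout ((Finset.univ.erase i).erase j) hα ?_ (lsub_homog M hG) (m := vm (v i) G) ?_ s w
    (fun k => vm (v k) G) ?_ ?_ ?_ hbig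
  · rw [← hf]
    exact lin_transport h hA0 hA h2 h1 hM hMi
  · apply lsub_mem
    rw [hMi]
    exact (le_vm_iff hG0 _).1 le_rfl
  · intro k hk l hl
    simp only [Finset.coe_erase, Set.mem_sdiff, Set.mem_singleton_iff] at hk hl
    exact hs k l hk.1.2 hl.1.2
  · intro k hk
    simp only [Finset.mem_erase] at hk
    rw [← hf, eval_lsub, (hc k hk.2.1).2, homog_eval_smul hA, h1 k hk.1, mul_zero]
  · intro k hk
    simp only [Finset.mem_erase] at hk
    apply lsub_mem
    rw [(hc k hk.2.1).2]
    exact smul_mem_vI hG (hc k hk.2.1).1 ((le_vm_iff hG0 _).1 le_rfl)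

lemma A_vm_i {v : Fin 8 → Fin 3 → ℂ} (h : GP v) {A : Poly3} (hA0 : A ≠ 0) (hA : A.IsHomogeneous 3)
    {i j : Fin 8} (h2 : A ∈ vI (v i) ^ 2) (h1 : ∀ k, k ≠ j → eval (v k) A = 0) :
    vm (v i) A ≤ 2 := by
  obtain ⟨M, α, r1, r2, δ0, δ1, δ2, δ3, s, w, c, hM, hMi, hα, hf, hc, hs⟩ := coords h hA0 hA h2 h1
  by_contra hlt
  have h3 : A ∈ vI (v i) ^ 3 := (le_vm_iff hA0 3).1 (by omega)
  rw [← hMi] at h3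
  have hm := lsub_mem M h3
  have hh := lsub_homog M hA
  rw [hf] at hm hh
  apply hα
  have hz : ∀ k, k = toF ![2,0,1] ∨ k = toF ![1,1,1] ∨ k = toF ![0,2,1] →
      coeff k (ncub α r1 r2 δ0 δ1 δ2 δ3) = 0 := by
    rintro k (rfl | rfl | rfl) <;> exact coeff_zero_of_mem_e3 hh hm _ (by simp [toF])
  -- restrict to (t,0,z)
  have e := congrArg (fun P => eval ![1,0,1] P - eval ![1,0,0] P) (homog_sum hh)
  have z1 := coeff_zero_of_mem_e3 hh hm (toF ![0,0,3]) (by simp [toF])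
  have z2 := coeff_zero_of_mem_e3 hh hm (toF ![0,1,2]) (by simp [toF])
  have z3 := coeff_zero_of_mem_e3 hh hm (toF ![1,0,2]) (by simp [toF])
  have z4 := coeff_zero_of_mem_e3 hh hm (toF ![2,0,1]) (by simp [toF])
  have z5 := coeff_zero_of_mem_e3 hh hm (toF ![1,1,1]) (by simp [toF])
  have z6 := coeff_zero_of_mem_e3 hh hm (toF ![0,2,1]) (by simp [toF])
  rw [show Finset.Nat.antidiagonalTuple 3 3 = {![0,0,3], ![0,1,2], ![1,0,2], ![2,0,1], ![1,1,1],
    ![0,2,1], ![3,0,0], ![2,1,0], ![1,2,0], ![0,3,0]} from by decide] at e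
  repeat rw [Finset.sum_insert (by decide)] at e
  rw [Finset.sum_singleton, z1, z2, z3, z4, z5, z6] at e
  simp only [eval_monomial, map_add, map_zero, zero_mul, Finsupp.prod_fintype, pow_zero,
    implies_true, Fin.prod_univ_three] at e
  simpa [toF, ncub] using e

lemma A_vm_k {v : Fin 8 → Fin 3 → ℂ} (h : GP v) {A : Poly3} (hA0 : A ≠ 0) (hA : A.IsHomogeneous 3)
    {i j : Fin 8} (h2 : A ∈ vI (v i) ^ 2) (h1 : ∀ k, k ≠ j → eval (v k) A = 0) {k : Fin 8} (hk : k ≠ i) :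
    vm (v k) A ≤ 1 := by
  obtain ⟨M, α, r1, r2, δ0, δ1, δ2, δ3, s, w, c, hM, hMi, hα, hf, hc, hs⟩ := coords h hA0 hA h2 h1
  by_contra hlt
  have h3 : A ∈ vI (v k) ^ 2 := (le_vm_iff hA0 2).1 (by omega)
  have h4 := smul_mem_vI hA (hc k hk).1 h3
  rw [← (hc k hk).2] at h4
  have hm := lsub_mem M h4
  have hnl := lin_transport h hA0 hA h2 h1 hM hMi (s k)
  rw [hf] at hm hnl
  rw [← hasMultGE_iff] at hm
  have d0 := hm ![0,0,0] (by simp)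
  have d1 := hm ![0,0,1] (by simp)
  simp [iterDeriv, ncub, pderiv_X] at d0 d1
  apply hnl
  apply lin_dvd_of
  intro y z
  have d1' : α * (s k - r1) * (s k - r2) = 0 := by simpa using d1
  simp [ncub]
  linear_combination (z * y ^ 2 - w k * y ^ 3) * d1' + y ^ 3 * d0

/-! ### The main bound -/

/-- multiplicities of the auxiliary cubic -/
def mA (i j k : Fin 8) : ℕ := if k = i then 2 else if k = j then 0 else 1

lemma exists_A {v : Fin 8 → Fin 3 → ℂ} (h : GP v) {i j : Fin 8} (hij : i ≠ j) :
    ∃ A : Poly3, A ≠ 0 ∧ A.IsHomogeneous 3 ∧ A ∈ vI (v i) ^ 2 ∧ ∀ k, k ≠ j → eval (v k) A = 0 := by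
  obtain ⟨A, hA0, hA, hm⟩ := exists_curve v h.ne0 (mA i j) 3 (by revert i j; decide)
  have h2 : A ∈ vI (v i) ^ 2 := by simpa [mA] using hm i
  refine ⟨A, hA0, hA, h2, fun k hk => ?_⟩
  rw [← vI_pow_one]
  by_cases hki : k = i
  · subst hki
    exact Ideal.pow_le_pow_right (by norm_num) h2
  · simpa [mA, hki, hk] using hm k

lemma A_sum {v : Fin 8 → Fin 3 → ℂ} (h : GP v) {A : Poly3} (hA0 : A ≠ 0) (hA : A.IsHomogeneous 3)
    {i j : Fin 8} (hij : i ≠ j) (h2 : A ∈ vI (v i) ^ 2) (h1 : ∀ k, k ≠ j → eval (v k) A = 0) :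
    ∑ k, vm (v k) A ≤ 8 := by
  have hle : ∀ k, vm (v k) A ≤ mA i j k := by
    intro k
    by_cases hki : k = i
    · subst hki
      simpa [mA] using A_vm_i h hA0 hA h2 h1
    · by_cases hkj : k = j
      · subst hkj
        simp only [mA, hki, if_false, if_true]
        by_contra hpos
        have h3 : eval (v k) A = 0 := by
          rw [← vI_pow_one, ← le_vm_iff hA0]; omega
        refine h.cub A hA0 hA (fun l => ?_) i h2
        by_cases hl : l = k
        · rw [hl, h3]
        · exact h1 l hl
      · simpa [mA, hki, hkj] using A_vm_k h hA0 hA h2 h1 hki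
  refine (Finset.sum_le_sum fun k _ => hle k).trans ?_
  clear hle h1 h2
  revert i j; decide

lemma vm_unit {v : Fin 3 → ℂ} {G : Poly3} (h0 : G ≠ 0) (h : G.IsHomogeneous 0) : vm v G = 0 := by
  by_contra hpos
  have h3 : eval v G = 0 := by
    rw [← vI_pow_one, ← le_vm_iff h0]; omega
  have hu := (isUnit_of_homog_zero h0 h).map (eval v)
  rw [h3] at hu
  exact not_isUnit_zero hu

lemma exists_pair (N : Fin 8 → ℕ) (d : ℕ) (hd : 1 ≤ d) (hd6 : d ≤ 6) (hS : 3 * d ≤ ∑ k, N k) :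
    ∃ i j, i ≠ j ∧ 3 * d + N j < ∑ k, N k + N i := by
  by_contra hcon
  push Not at hcon
  rw [Fin.sum_univ_eight] at *
  have a1 := hcon 0 1 (by decide)
  have a2 := hcon 0 2 (by decide)
  have a3 := hcon 0 3 (by decide)
  have a4 := hcon 0 4 (by decide)
  have a5 := hcon 0 5 (by decide)
  have a6 := hcon 0 6 (by decide)
  have a7 := hcon 0 7 (by decide)
  have b1 := hcon 1 0 (by decide)
  have b2 := hcon 2 0 (by decide)
  have b3 := hcon 3 0 (by decide)
  have b4 := hcon 4 0 (by decide)
  have b5 := hcon 5 0 (by decide)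
  have b6 := hcon 6 0 (by decide)
  have b7 := hcon 7 0 (by decide)
  clear hcon
  omega

lemma main_bound {v : Fin 8 → Fin 3 → ℂ} (h : GP v) : ∀ (d : ℕ), 1 ≤ d → d ≤ 6 → ∀ G : Poly3, G ≠ 0 →
    G.IsHomogeneous d → ∑ k, vm (v k) G < 3 * d := by
  intro d
  induction d using Nat.strong_induction_on with
  | _ d ih =>
  intro hd hd6 G hG0 hG
  by_contra hlt
  push Not at hlt
  obtain ⟨i, j, hij, hp⟩ := exists_pair (fun k => vm (v k) G) d hd hd6 hlt
  obtain ⟨A, hA0, hA, h2, h1⟩ := exists_A h hij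
  have hsum := A_sum h hA0 hA hij h2 h1
  have hdvd : A ∣ G := by
    apply A_dvd h hA0 hA h2 h1 hG0 hG
    have e1 := Finset.add_sum_erase Finset.univ (fun k => vm (v k) G) (Finset.mem_univ i)
    have e2 := Finset.add_sum_erase (Finset.univ.erase i) (fun k => vm (v k) G)
      (Finset.mem_erase.2 ⟨hij.symm, Finset.mem_univ j⟩)
    omega
  obtain ⟨H, rfl⟩ := hdvd
  have hH0 : H ≠ 0 := right_ne_zero_of_mul hG0
  obtain ⟨a, b, hab, ha, hb⟩ := homog_factors hG hG0
  have ha3 : a = 3 := ha.inj_right hA hA0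
  have hs : ∑ k, vm (v k) (A * H) = ∑ k, vm (v k) A + ∑ k, vm (v k) H := by
    rw [← Finset.sum_add_distrib]
    exact Finset.sum_congr rfl fun k _ => vm_mul hA0 hH0
  by_cases hb0 : b = 0
  · subst hb0
    have : ∑ k, vm (v k) H = 0 := Finset.sum_eq_zero fun k _ => vm_unit hH0 hb
    omega
  · have := ih b (by omega) (by omega) (by omega) H hH0 hb
    omega

lemma gp_of (p : Fin 8 → P2) (hp : GenPos p) : GP (fun k => (p k).rep) where
  ne0 k := (p k).rep_nonzero
  lin a b c hab hac hbc L hL0 hL ha hb hc := by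
    refine hp.2.1 ⟨![a, b, c], ?_⟩ ⟨L, hL0, hL, ?_⟩
    · intro x y hxy
      fin_cases x <;> fin_cases y <;> simp_all
    · intro k
      fin_cases k
      · exact ha
      · exact hb
      · exact hc
  con a b Q hQ0 hQ hk := by
    have hcard : 6 ≤ ((Finset.univ.erase a).erase b).card := by
      clear hk; revert a b; decide
    obtain ⟨t, ht, htc⟩ := Finset.exists_subset_card_eq hcard
    refine hp.2.2.1 (t.orderEmbOfFin htc).toEmbedding ⟨Q, hQ0, hQ, fun k => ?_⟩
    have := ht (Finset.orderEmbOfFin_mem t htc k)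
    simp only [Finset.mem_erase] at this
    exact hk _ this.2.1 this.1
  cub F hF0 hF hk i hi :=
    hp.2.2.2 (Function.Embedding.refl _) ⟨F, hF0, hF, fun k => hk k, i, (hasMultGE_iff _ _ _).2 hi⟩

/-- multiplicities of the sextic -/
def mS (k : Fin 8) : ℕ := if k = 7 then 3 else 2

lemma exists_sextic (p : Fin 8 → P2) (hp : GenPos p) :
    ∃ F : Poly3, F.IsHomogeneous 6 ∧ Irreducible F ∧ ∀ k, pMult F (p k) = mS k := by
  have h := gp_of p hp
  obtain ⟨F, hF0, hF, hm⟩ := exists_curve _ h.ne0 mS 6 (by decide)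
  have hge : ∀ k, mS k ≤ vm (p k).rep F := fun k => (le_vm_iff hF0 _).2 (hm k)
  have hsum := main_bound h 6 (by norm_num) (by norm_num) F hF0 hF
  have hm17 : ∑ k, mS k = 17 := by decide
  have hsum2 : 17 ≤ ∑ k, vm (p k).rep F := by
    rw [← hm17]; exact Finset.sum_le_sum fun k _ => hge k
  refine ⟨F, hF, ?_, ?_⟩
  · constructor
    · intro hu
      obtain ⟨G, hG⟩ := hu.exists_right_inv
      have h1 : (F * G).IsHomogeneous 0 := by rw [hG]; exact isHomogeneous_one _ _
      have h10 : F * G ≠ 0 := by rw [hG]; exact one_ne_zero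
      obtain ⟨a, b, hab, ha, hb⟩ := homog_factors h1 h10
      have := ha.inj_right hF hF0
      omega
    · intro G H hGH
      have hGH0 : G * H ≠ 0 := hGH ▸ hF0
      have hG0 := left_ne_zero_of_mul hGH0
      have hH0 := right_ne_zero_of_mul hGH0
      obtain ⟨a, b, hab, ha, hb⟩ := homog_factors (hGH ▸ hF) hGH0
      by_cases ha0 : a = 0
      · left; subst ha0; exact isUnit_of_homog_zero hG0 ha
      by_cases hb0 : b = 0
      · right; subst hb0; exact isUnit_of_homog_zero hH0 hb
      have s1 := main_bound h a (by omega) (by omega) G hG0 ha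
      have s2 := main_bound h b (by omega) (by omega) H hH0 hb
      have hs : ∑ k, vm (p k).rep F = ∑ k, vm (p k).rep G + ∑ k, vm (p k).rep H := by
        rw [hGH, ← Finset.sum_add_distrib]
        exact Finset.sum_congr rfl fun k _ => vm_mul hG0 hH0
      omega
  · intro k
    rw [pMult_eq hF0]
    have hle : ∑ k, vm (p k).rep F ≤ ∑ k, mS k := by omega
    have heq := (Finset.sum_eq_sum_iff_of_le (fun k (_ : k ∈ Finset.univ) => hge k)).1
      (le_antisymm (by omega) hle)
    exact (heq k (Finset.mem_univ k)).symm

/-- Let `X₇` be the blow-up of `ℙ²` at `7` points in general position and let `x` be a point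
of `X₇` in general position.  Then there is an irreducible and reduced member of `|-2K_{X₇}|`
(an irreducible curve of class `6H - 2E₁ - ⋯ - 2E₇`) with multiplicity `3` at `x`;
equivalently, there is an irreducible and reduced plane sextic with multiplicity exactly `3`
at `μ₇(x)` and multiplicity exactly `2` at each of the seven blown-up points. -/
theorem exists_bianticanonical_member_mult_three
    (pts : Fin 7 → P2) (hpts : GenPos pts)
    (B : BlowupP2 7 pts) (x : B.X) (hx : B.genPosPt x) :
    (∃ C : B.Curve, B.degH C = 6 ∧ (∀ i, B.multE C i = 2) ∧ B.mult x C = 3) ∧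
    (∃ F : MvPolynomial (Fin 3) ℂ, F.IsHomogeneous 6 ∧ Irreducible F ∧
      pMult F (B.μ x) = 3 ∧ ∀ i, pMult F (pts i) = 2) := by
  obtain ⟨hx1, hx2⟩ := hx
  obtain ⟨F, hF, hirr, hm⟩ := exists_sextic _ hx2
  have m7 : pMult F (B.μ x) = 3 := by
    have h7 := hm (Fin.last 7)
    rw [Fin.snoc_last] at h7
    exact h7
  have mi : ∀ i, pMult F (pts i) = 2 := by
    intro i
    have hi := hm i.castSucc
    rw [Fin.snoc_castSucc] at hi
    rw [hi]
    clear hi; revert i; decide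
  refine ⟨?_, F, hF, hirr, m7, mi⟩
  obtain ⟨C, hC1, hC2, hC3, -⟩ := B.strict_exists 6 F hF hirr
  refine ⟨C, hC1, fun i => ?_, ?_⟩
  · rw [hC2 i, mi i]; rfl
  · rw [(hC3 x hx1).2, m7]
end
end

section
/- Let x_1, …, x_6 and x be 7 points of the complex projective plane such that the set {x_1, …, x_6, x} is in general position, and let D be a plane cubic curve passing through x_1, …, x_6 with multiplicity at least 2 at x. Then D is irreducible and reduced, mult_x D = 2, and every other point of D is a smooth point of D. -/
open MvPolynomial

noncomputable section

lemma aux_pderiv_comm (i j : Fin 3) (F : MvPolynomial (Fin 3) ℂ) :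
    pderiv i (pderiv j F) = pderiv j (pderiv i F) := by
  have h : ⁅(pderiv i : Derivation ℂ (MvPolynomial (Fin 3) ℂ) (MvPolynomial (Fin 3) ℂ)),
      (pderiv j : Derivation ℂ (MvPolynomial (Fin 3) ℂ) (MvPolynomial (Fin 3) ℂ))⁆ = 0 := by
    apply MvPolynomial.derivation_ext
    intro k
    simp [Derivation.commutator_apply, pderiv_X, Pi.single_apply, apply_ite]
  have := DFunLike.congr_fun h F
  simpa [Derivation.commutator_apply, sub_eq_zero] using this

lemma aux_euler {n : ℕ} {G : MvPolynomial (Fin 3) ℂ} (h : G.IsHomogeneous n) (w : Fin 3 → ℂ) :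
    (n : ℂ) * eval w G = w 0 * eval w (pderiv 0 G) + w 1 * eval w (pderiv 1 G)
      + w 2 * eval w (pderiv 2 G) := by
  have := congrArg (eval w) h.sum_X_mul_pderiv
  simp [Fin.sum_univ_three] at this
  rw [this]

lemma aux_const {G : MvPolynomial (Fin 3) ℂ} (h : G.IsHomogeneous 0) (w : Fin 3 → ℂ) :
    eval w G = coeff 0 G := by
  rw [← totalDegree_zero_iff_isHomogeneous, totalDegree_eq_zero_iff_eq_C] at h
  rw [h]; simp

lemma aux_lin {G : MvPolynomial (Fin 3) ℂ} (h : G.IsHomogeneous 1) :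
    ∀ w, eval w G = w 0 * coeff 0 (pderiv 0 G) + w 1 * coeff 0 (pderiv 1 G)
      + w 2 * coeff 0 (pderiv 2 G) := by
  intro w
  have := aux_euler h w
  rw [aux_const (h.pderiv (i := 0)), aux_const (h.pderiv (i := 1)),
    aux_const (h.pderiv (i := 2))] at this
  simpa using this

lemma aux_quad {G : MvPolynomial (Fin 3) ℂ} (h : G.IsHomogeneous 2) :
    ∃ T : Fin 3 → Fin 3 → ℂ, (∀ i j, T i j = T j i) ∧
      (∀ i w, eval w (pderiv i G) = w 0 * T i 0 + w 1 * T i 1 + w 2 * T i 2) ∧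
      (∀ w, 2 * eval w G = w 0 * eval w (pderiv 0 G) + w 1 * eval w (pderiv 1 G)
      + w 2 * eval w (pderiv 2 G)) := by
  refine ⟨fun i j => coeff 0 (pderiv j (pderiv i G)), ?_, ?_, ?_⟩
  · intro i j; simp only [aux_pderiv_comm i j]
  · intro i w
    exact aux_lin (h.pderiv (i := i)) w
  · intro w; exact_mod_cast aux_euler h w

lemma aux_line {F : MvPolynomial (Fin 3) ℂ} (h : F.IsHomogeneous 3) (u v : Fin 3 → ℂ) (s t : ℂ) :
    eval (s • u + t • v) F = s^3 * eval u F
      + s^2*t*(v 0 * eval u (pderiv 0 F) + v 1 * eval u (pderiv 1 F) + v 2 * eval u (pderiv 2 F))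
      + s*t^2*(u 0 * eval v (pderiv 0 F) + u 1 * eval v (pderiv 1 F) + u 2 * eval v (pderiv 2 F))
      + t^3 * eval v F := by
  have hE := aux_euler h
  have h2 : ∀ i w, 2 * eval w (pderiv i F) = _ := fun i w => by
    exact_mod_cast aux_euler (h.pderiv (i := i)) w
  have h1 : ∀ i j w, eval w (pderiv i (pderiv j F)) = _ := fun i j w =>
    aux_lin ((h.pderiv (i := j)).pderiv (i := i)) w
  have e : ∀ w, 6 * eval w F = w 0 * (2 * eval w (pderiv 0 F)) + w 1 * (2 * eval w (pderiv 1 F))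
      + w 2 * (2 * eval w (pderiv 2 F)) := by
    intro w; have := hE w; push_cast at this; linear_combination 2 * this
  apply mul_left_cancel₀ (show (6:ℂ) ≠ 0 by norm_num)
  have r : 6 * (s^3 * eval u F
      + s^2*t*(v 0 * eval u (pderiv 0 F) + v 1 * eval u (pderiv 1 F) + v 2 * eval u (pderiv 2 F))
      + s*t^2*(u 0 * eval v (pderiv 0 F) + u 1 * eval v (pderiv 1 F) + u 2 * eval v (pderiv 2 F))
      + t^3 * eval v F) = s^3 * (6 * eval u F)
      + 3*s^2*t*(v 0 * (2 * eval u (pderiv 0 F)) + v 1 * (2 * eval u (pderiv 1 F))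
        + v 2 * (2 * eval u (pderiv 2 F)))
      + 3*s*t^2*(u 0 * (2 * eval v (pderiv 0 F)) + u 1 * (2 * eval v (pderiv 1 F))
        + u 2 * (2 * eval v (pderiv 2 F)))
      + t^3 * (6 * eval v F) := by ring
  rw [r]
  simp only [e, h2, h1, aux_pderiv_comm 1 0, aux_pderiv_comm 2 0, aux_pderiv_comm 2 1,
    Pi.add_apply, Pi.smul_apply, smul_eq_mul]
  ring

/-- the linear form with coefficient vector `n` -/
def auxL (n : Fin 3 → ℂ) : MvPolynomial (Fin 3) ℂ := C (n 0) * X 0 + C (n 1) * X 1 + C (n 2) * X 2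

lemma auxL_eval (n w : Fin 3 → ℂ) : eval w (auxL n) = w ⬝ᵥ n := by
  simp [auxL, dotProduct, Fin.sum_univ_three]; ring

lemma auxL_hom (n : Fin 3 → ℂ) : (auxL n).IsHomogeneous 1 :=
  ((isHomogeneous_C_mul_X _ _).add (isHomogeneous_C_mul_X _ _)).add (isHomogeneous_C_mul_X _ _)

lemma auxL_ne {n : Fin 3 → ℂ} (hn : n ≠ 0) : auxL n ≠ 0 := by
  intro h
  apply hn
  funext i
  have := auxL_eval n (Pi.single i 1)
  rw [h] at this
  simpa using this.symm

lemma aux_span {u v w : Fin 3 → ℂ} (h : LinearIndependent ℂ ![u, v])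
    (hw : w ⬝ᵥ (crossProduct u v) = 0) : ∃ s t : ℂ, w = s • u + t • v := by
  by_contra hc
  have : LinearIndependent ℂ ![w, u, v] := by
    rw [show (![w, u, v] : Fin 3 → Fin 3 → ℂ) = Fin.cons w ![u, v] from rfl,
      linearIndependent_finCons]
    refine ⟨h, fun hm => hc ?_⟩
    simp only [Matrix.range_cons, Matrix.range_empty, Set.union_empty, Set.singleton_union] at hm
    obtain ⟨s, t, hst⟩ := Submodule.mem_span_pair.1 hm
    exact ⟨s, t, hst.symm⟩
  rw [triple_product_eq_det] at hw
  have h2 := (Matrix.linearIndependent_rows_iff_isUnit (A := (Matrix.of ![w, u, v]))).1 this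
  rw [Matrix.isUnit_iff_isUnit_det] at h2
  exact h2.ne_zero hw

lemma aux_span3 {u v a : Fin 3 → ℂ} (h : a ⬝ᵥ (crossProduct u v) ≠ 0) (w : Fin 3 → ℂ) :
    ∃ r s t : ℂ, w = r • a + s • u + t • v := by
  have hl : LinearIndependent ℂ ![u, v] := by
    rw [← crossProduct_ne_zero_iff_linearIndependent]
    rintro h0; simp [h0] at h
  have : (w - ((w ⬝ᵥ (crossProduct u v)) / (a ⬝ᵥ (crossProduct u v))) • a)
      ⬝ᵥ (crossProduct u v) = 0 := by
    rw [sub_dotProduct, smul_dotProduct, smul_eq_mul]; field_simp; ring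
  obtain ⟨s, t, hst⟩ := aux_span hl this
  exact ⟨_, s, t, by rw [add_assoc, ← hst]; abel⟩

lemma aux_ne_indep {x q : P2} (h : x ≠ q) : LinearIndependent ℂ ![x.rep, q.rep] := by
  have := (Projectivization.independent_iff).1 ((Projectivization.independent_pair_iff_ne x q).2 h)
  have e : (![x.rep, q.rep] : Fin 2 → Fin 3 → ℂ) = Projectivization.rep ∘ ![x, q] := by
    funext i; fin_cases i <;> rfl
  rw [e]; exact this

lemma aux_no_line {F : MvPolynomial (Fin 3) ℂ} (hF3 : F.IsHomogeneous 3) (hF : Irreducible F)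
    {u v : Fin 3 → ℂ} (h : LinearIndependent ℂ ![u, v])
    (hv : ∀ s t : ℂ, eval (s • u + t • v) F = 0) : False := by
  set n := crossProduct u v with hn
  have hn0 : n ≠ 0 := crossProduct_ne_zero_iff_linearIndependent.2 h
  have hm : F ∈ vanishingIdeal ℂ (zeroLocus ℂ (Ideal.span {auxL n})) := by
    rw [zeroLocus_span]
    intro w hw
    have hw' : eval w (auxL n) = 0 := by simpa [aeval_eq_eval] using hw
    rw [auxL_eval] at hw'
    obtain ⟨s, t, rfl⟩ := aux_span h hw'
    simpa [aeval_eq_eval] using hv s t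
  rw [vanishingIdeal_zeroLocus_eq_radical] at hm
  obtain ⟨m, hm⟩ := hm
  rw [Ideal.mem_span_singleton, dvd_prime_pow hF.prime] at hm
  obtain ⟨k, -, hk⟩ := hm
  obtain ⟨c, hc⟩ := hk.symm
  have hc0 : (c : MvPolynomial (Fin 3) ℂ).totalDegree = 0 :=
    (MvPolynomial.isUnit_iff_totalDegree_of_isReduced.1 c.isUnit).2
  have h1 := (auxL_hom n).totalDegree (auxL_ne hn0)
  have h2 := (hF3.pow k).totalDegree (pow_ne_zero _ hF.ne_zero)
  rw [← hc, totalDegree_mul_of_isDomain (pow_ne_zero _ hF.ne_zero) c.ne_zero, h2, hc0] at h1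
  omega

lemma aux_top {A B : MvPolynomial (Fin 3) ℂ} :
    homogeneousComponent (A.totalDegree + B.totalDegree) (A * B) =
      homogeneousComponent A.totalDegree A * homogeneousComponent B.totalDegree B := by
  classical
  ext d
  rw [coeff_homogeneousComponent]
  split_ifs with hd
  · rw [coeff_mul, coeff_mul]
    refine Finset.sum_congr rfl fun x hx => ?_
    rw [coeff_homogeneousComponent, coeff_homogeneousComponent]
    have hx' : x.1.degree + x.2.degree = A.totalDegree + B.totalDegree := by
      rw [← hd, ← Finset.HasAntidiagonal.mem_antidiagonal.1 hx, map_add]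
    rcases lt_trichotomy x.1.degree A.totalDegree with h | h | h
    · have : coeff x.2 B = 0 := coeff_eq_zero_of_totalDegree_lt (by
        change _ < x.2.degree; omega)
      simp [this]
    · rw [if_pos h, if_pos (by omega)]
    · have : coeff x.1 A = 0 := coeff_eq_zero_of_totalDegree_lt h
      simp [this]
  · exact (((homogeneousComponent_isHomogeneous _ A).mul
      (homogeneousComponent_isHomogeneous _ B)).coeff_eq_zero hd).symm

lemma aux_unit {A : MvPolynomial (Fin 3) ℂ} (h0 : A ≠ 0) (h : A.totalDegree = 0) : IsUnit A := by
  rw [totalDegree_eq_zero_iff_eq_C] at h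
  rw [h] at h0 ⊢
  refine (IsUnit.mk0 _ ?_).map C
  rintro h1; simp [h1] at h0

lemma aux_factor {F : MvPolynomial (Fin 3) ℂ} (hF0 : F ≠ 0) (hF3 : F.IsHomogeneous 3)
    (hF : ¬ Irreducible F) : ∃ L Q : MvPolynomial (Fin 3) ℂ, L.IsHomogeneous 1 ∧
      Q.IsHomogeneous 2 ∧ F = L * Q := by
  have hu : ¬ IsUnit F := by
    intro h
    have := (MvPolynomial.isUnit_iff_totalDegree_of_isReduced.1 h).2
    rw [hF3.totalDegree hF0] at this
    omega
  rw [irreducible_iff] at hF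
  push Not at hF
  obtain ⟨A, B, hAB, hA, hB⟩ := hF hu
  have hA0 : A ≠ 0 := by rintro rfl; simp at hAB; exact hF0 hAB
  have hB0 : B ≠ 0 := by rintro rfl; simp at hAB; exact hF0 hAB
  have hd := hF3.totalDegree hF0
  rw [hAB, totalDegree_mul_of_isDomain hA0 hB0] at hd
  have hA1 : A.totalDegree ≠ 0 := fun h => hA (aux_unit hA0 h)
  have hB1 : B.totalDegree ≠ 0 := fun h => hB (aux_unit hB0 h)
  have ht := aux_top (A := A) (B := B)
  rw [hd, ← hAB, homogeneousComponent_eq_self hF3] at ht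
  have ha := homogeneousComponent_isHomogeneous A.totalDegree A
  have hb := homogeneousComponent_isHomogeneous B.totalDegree B
  have : (A.totalDegree = 1 ∧ B.totalDegree = 2) ∨ (A.totalDegree = 2 ∧ B.totalDegree = 1) := by
    omega
  rcases this with ⟨h1, h2⟩ | ⟨h1, h2⟩
  · rw [h1] at ha ht; rw [h2] at hb ht
    exact ⟨_, _, ha, hb, ht⟩
  · rw [h1] at ha ht; rw [h2] at hb ht
    exact ⟨_, _, hb, ha, by rw [ht, mul_comm]⟩

lemma aux_quad_zero {Q : MvPolynomial (Fin 3) ℂ} (hQ : Q.IsHomogeneous 2)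
    {x a b c : Fin 3 → ℂ} (hx : ∀ i, eval x (pderiv i Q) = 0) (ha : eval a Q = 0)
    (hb : eval b Q = 0) (hc : eval c Q = 0)
    (h1 : x ⬝ᵥ (crossProduct a b) ≠ 0) (h2 : x ⬝ᵥ (crossProduct b c) ≠ 0)
    (h3 : x ⬝ᵥ (crossProduct a c) ≠ 0) : Q = 0 := by
  obtain ⟨T, hT, hd, he⟩ := aux_quad hQ
  have key : ∀ r s t : ℂ, eval (r • x + s • a + t • b) Q =
      s * t * (b 0 * eval a (pderiv 0 Q) + b 1 * eval a (pderiv 1 Q)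
        + b 2 * eval a (pderiv 2 Q)) := by
    intro r s t
    have x0 := hx 0
    have x1 := hx 1
    have x2 := hx 2
    have ea := he a
    have eb := he b
    have ec := he (r • x + s • a + t • b)
    rw [ha] at ea
    rw [hb] at eb
    simp only [hd, hT 1 0, hT 2 0, hT 2 1, Pi.add_apply, Pi.smul_apply, smul_eq_mul] at *
    linear_combination (1/2) * ec - (s^2/2) * ea - (t^2/2) * eb
      + (r/2) * ((r * x 0 + 2 * s * a 0 + 2 * t * b 0) * x0
        + (r * x 1 + 2 * s * a 1 + 2 * t * b 1) * x1
        + (r * x 2 + 2 * s * a 2 + 2 * t * b 2) * x2)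
  obtain ⟨r, s, t, rfl⟩ := aux_span3 h1 c
  rw [key] at hc
  have ht : t ≠ 0 := by
    rintro rfl
    apply h3
    simp [dotProduct, Fin.sum_univ_three, cross_apply]; ring
  have hs : s ≠ 0 := by
    rintro rfl
    apply h2
    simp [dotProduct, Fin.sum_univ_three, cross_apply]; ring
  have h0 := (mul_eq_zero.1 hc).resolve_left (mul_ne_zero hs ht)
  apply hQ.eq_zero_of_forall_eval_eq_zero
  intro w
  obtain ⟨r, s, t, rfl⟩ := aux_span3 h1 w
  rw [key, h0, mul_zero]

lemma aux_mult {F : MvPolynomial (Fin 3) ℂ} {v : Fin 3 → ℂ} (h : HasMultGE F v 2) :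
    eval v F = 0 ∧ ∀ i, eval v (pderiv i F) = 0 := by
  refine ⟨by simpa [iterDeriv] using h ![0,0,0] (by simp), fun i => ?_⟩
  fin_cases i
  · simpa [iterDeriv] using h ![1,0,0] (by simp)
  · simpa [iterDeriv] using h ![0,1,0] (by simp)
  · simpa [iterDeriv] using h ![0,0,1] (by simp)

lemma aux_mult3 {F : MvPolynomial (Fin 3) ℂ} {v : Fin 3 → ℂ} (h : HasMultGE F v 3) :
    eval v (pderiv 0 (pderiv 0 F)) = 0 ∧ eval v (pderiv 1 (pderiv 1 F)) = 0 ∧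
      eval v (pderiv 2 (pderiv 2 F)) = 0 ∧ eval v (pderiv 0 (pderiv 1 F)) = 0 ∧
      eval v (pderiv 0 (pderiv 2 F)) = 0 ∧ eval v (pderiv 1 (pderiv 2 F)) = 0 := by
  have h00 : eval v (pderiv 0 (pderiv 0 F)) = 0 := by
    simpa [iterDeriv] using h ![2,0,0] (by simp)
  have h11 : eval v (pderiv 1 (pderiv 1 F)) = 0 := by
    simpa [iterDeriv] using h ![0,2,0] (by simp)
  have h22 : eval v (pderiv 2 (pderiv 2 F)) = 0 := by
    simpa [iterDeriv] using h ![0,0,2] (by simp)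
  have h01 : eval v (pderiv 0 (pderiv 1 F)) = 0 := by
    simpa [iterDeriv] using h ![1,1,0] (by simp)
  have h02 : eval v (pderiv 0 (pderiv 2 F)) = 0 := by
    simpa [iterDeriv] using h ![1,0,1] (by simp)
  have h12 : eval v (pderiv 1 (pderiv 2 F)) = 0 := by
    simpa [iterDeriv] using h ![0,1,1] (by simp)
  exact ⟨h00, h11, h22, h01, h02, h12⟩

lemma aux_cone {F : MvPolynomial (Fin 3) ℂ} (h : F.IsHomogeneous 3) {u : Fin 3 → ℂ}
    (h3 : eval u (pderiv 0 (pderiv 0 F)) = 0 ∧ eval u (pderiv 1 (pderiv 1 F)) = 0 ∧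
      eval u (pderiv 2 (pderiv 2 F)) = 0 ∧ eval u (pderiv 0 (pderiv 1 F)) = 0 ∧
      eval u (pderiv 0 (pderiv 2 F)) = 0 ∧ eval u (pderiv 1 (pderiv 2 F)) = 0) (v : Fin 3 → ℂ) :
    u 0 * eval v (pderiv 0 F) + u 1 * eval v (pderiv 1 F) + u 2 * eval v (pderiv 2 F) = 0 := by
  have h2 : ∀ i w, 2 * eval w (pderiv i F) = _ := fun i w => by
    exact_mod_cast aux_euler (h.pderiv (i := i)) w
  have h1 : ∀ i j w, eval w (pderiv i (pderiv j F)) = _ := fun i j w =>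
    aux_lin ((h.pderiv (i := j)).pderiv (i := i)) w
  obtain ⟨e00, e11, e22, e01, e02, e12⟩ := h3
  have f0 := h2 0 v
  have f1 := h2 1 v
  have f2 := h2 2 v
  simp only [h1, aux_pderiv_comm 1 0, aux_pderiv_comm 2 0, aux_pderiv_comm 2 1] at *
  linear_combination (1/2) * (u 0 * f0 + u 1 * f1 + u 2 * f2 + v 0 ^ 2 * e00 + v 1 ^ 2 * e11
    + v 2 ^ 2 * e22 + 2 * v 0 * v 1 * e01 + 2 * v 0 * v 2 * e02 + 2 * v 1 * v 2 * e12)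

lemma aux_irred (P : Fin 7 → P2) (h : GenPos P)
    (F : MvPolynomial (Fin 3) ℂ) (hF0 : F ≠ 0) (hF3 : F.IsHomogeneous 3)
    (hvan : ∀ i, pVanish F (P i)) (hmult : pHasMultGE F (P 6) 2) : Irreducible F := by
  classical
  by_contra hF
  obtain ⟨hinj, hline, hconic, -⟩ := h
  obtain ⟨L, Q, hL, hQ, rfl⟩ := aux_factor hF0 hF3 hF
  have hL0 : L ≠ 0 := left_ne_zero_of_mul hF0
  have hQ0 : Q ≠ 0 := right_ne_zero_of_mul hF0
  set SL := Finset.univ.filter fun i => pVanish L (P i) with hSL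
  set SQ := Finset.univ.filter fun i => pVanish Q (P i) with hSQ
  have cL : SL.card ≤ 2 := by
    by_contra hc
    obtain ⟨S, hS, hS3⟩ := Finset.exists_subset_card_eq (show 3 ≤ SL.card by omega)
    refine hline (S.orderEmbOfFin hS3).toEmbedding ⟨L, hL0, hL, fun k => ?_⟩
    exact (Finset.mem_filter.1 (hS (S.orderEmbOfFin_mem hS3 k))).2
  have cQ : SQ.card ≤ 5 := by
    by_contra hc
    obtain ⟨S, hS, hS3⟩ := Finset.exists_subset_card_eq (show 6 ≤ SQ.card by omega)
    refine hconic (S.orderEmbOfFin hS3).toEmbedding ⟨Q, hQ0, hQ, fun k => ?_⟩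
    exact (Finset.mem_filter.1 (hS (S.orderEmbOfFin_mem hS3 k))).2
  have hor : ∀ i, pVanish L (P i) ∨ pVanish Q (P i) := by
    intro i
    have := hvan i
    simpa [pVanish] using this
  obtain ⟨m0, m1⟩ := aux_mult hmult
  simp only [pderiv_mul, map_add, map_mul] at m0 m1
  by_cases hx : eval (P 6).rep L = 0
  · have hxQ : eval (P 6).rep Q = 0 := by
      by_contra hq
      have : ∀ i, eval (P 6).rep (pderiv i L) = 0 := by
        intro i
        have := m1 i
        rw [hx] at this
        simpa [hq] using this
      apply hL0
      apply hL.eq_zero_of_forall_eval_eq_zero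
      intro w
      rw [aux_lin hL w]
      simp only [aux_const (hL.pderiv)] at this
      simp [this]
    have hun : SL ∪ SQ = Finset.univ := by
      ext i; simp [hSL, hSQ, hor i]
    have hin : (6 : Fin 7) ∈ SL ∩ SQ := by
      exact Finset.mem_inter.2 ⟨Finset.mem_filter.2 ⟨Finset.mem_univ _, hx⟩,
        Finset.mem_filter.2 ⟨Finset.mem_univ _, hxQ⟩⟩
    have := Finset.card_union_add_card_inter SL SQ
    have h1 := Finset.card_pos.2 ⟨_, hin⟩
    rw [hun, Finset.card_univ, Fintype.card_fin] at this
    omega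
  · have hxQ : ∀ i, eval (P 6).rep (pderiv i Q) = 0 := by
      intro i
      have hq : eval (P 6).rep Q = 0 := by simpa [hx] using m0
      have := m1 i
      rw [hq] at this
      simpa [hx] using this
    have hc : 2 < ((Finset.univ \ SL).erase 6).card := by
      have h1 := Finset.card_sdiff_add_card_eq_card (Finset.subset_univ SL)
      have h2 := Finset.pred_card_le_card_erase (s := Finset.univ \ SL) (a := 6)
      rw [Finset.card_univ, Fintype.card_fin] at h1
      omega
    obtain ⟨a, ha, b, hb, c, hc, hab, hac, hbc⟩ := Finset.two_lt_card.1 hc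
    simp only [Finset.mem_erase, Finset.mem_sdiff, Finset.mem_univ, true_and, hSL,
      Finset.mem_filter] at ha hb hc
    have hdet : ∀ i j, i ≠ 6 → j ≠ 6 → i ≠ j →
        (P 6).rep ⬝ᵥ (crossProduct (P i).rep (P j).rep) ≠ 0 := by
      intro i j hi hj hij h0
      refine hline ⟨![6, i, j], ?_⟩ ⟨auxL (crossProduct (P i).rep (P j).rep), auxL_ne ?_,
        auxL_hom _, ?_⟩
      · intro k l hkl
        fin_cases k <;> fin_cases l <;> simp_all [eq_comm]
      · exact crossProduct_ne_zero_iff_linearIndependent.2 (aux_ne_indep (hinj.ne hij))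
      · intro k
        rw [pVanish, auxL_eval]
        fin_cases k
        · exact h0
        · exact dot_self_cross _ _
        · exact dot_cross_self _ _
    exact hQ0 (aux_quad_zero hQ hxQ ((hor a).resolve_left ha.2) ((hor b).resolve_left hb.2)
      ((hor c).resolve_left hc.2) (hdet _ _ ha.1 hb.1 hab) (hdet _ _ hb.1 hc.1 hbc)
      (hdet _ _ ha.1 hc.1 hac))

theorem cubic_with_double_point_is_irreducible
    (p : Fin 6 → P2) (x : P2) (h : GenPos (Fin.snoc p x : Fin 7 → P2))
    (F : MvPolynomial (Fin 3) ℂ) (hF0 : F ≠ 0) (hF3 : F.IsHomogeneous 3)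
    (hvan : ∀ i, pVanish F (p i)) (hmult : pHasMultGE F x 2) :
    Irreducible F ∧ pMult F x = 2 ∧
      (∀ q : P2, q ≠ x → pVanish F q → ∃ i, eval q.rep (pderiv i F) ≠ 0) := by
  have hlast : (Fin.snoc p x : Fin 7 → P2) 6 = x := Fin.snoc_last (α := fun _ => P2) x p
  have hcast : ∀ i : Fin 6, (Fin.snoc p x : Fin 7 → P2) i.castSucc = p i :=
    fun i => Fin.snoc_castSucc (α := fun _ => P2) x p i
  obtain ⟨m0, m1⟩ := aux_mult hmult
  have hirr : Irreducible F := by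
    refine aux_irred _ h F hF0 hF3 (fun i => ?_) (by rw [hlast]; exact hmult)
    induction i using Fin.lastCases with
    | last => exact hlast ▸ m0
    | cast i => rw [hcast]; exact hvan i
  refine ⟨hirr, ?_, ?_⟩
  · have hne : x ≠ p 0 := by
      rw [← hlast, ← hcast 0]
      exact h.1.ne (by decide)
    refine IsGreatest.csSup_eq ⟨hmult, fun m hm => ?_⟩
    by_contra hc
    have h3 : HasMultGE F x.rep 3 := fun k hk => hm k (by omega)
    refine aux_no_line hF3 hirr (aux_ne_indep hne) fun s t => ?_
    have hv : eval (p 0).rep F = 0 := hvan 0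
    rw [aux_line hF3, aux_cone hF3 (aux_mult3 h3), m0, m1, m1, m1, hv]
    ring
  · intro q hq hqF
    by_contra hc
    push Not at hc
    refine aux_no_line hF3 hirr (aux_ne_indep hq) fun s t => ?_
    have hv : eval q.rep F = 0 := hqF
    rw [aux_line hF3, m0, m1, m1, m1, hc, hc, hc, hv]
    ring
end
end
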